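/- arXiv:math/0608499 — 3 statements merged into one kernel-verified Lean document; each statement's English description precedes it below -/
import Mathlib

section
/- Fix n ≥ 3, θ₁ > 0 and k > 0. Let f(·;0) and f(·;θ₁) be probability densities on ℝ. For x ∈ ℝⁿ define N_θ(x) = ∫₀^∞ ∫_{-∞}^∞ ∏_{i=1}^n f(a + b·xᵢ ; θ) · b^{n-2} da db, and assume N₀(x) and N_{θ₁}(x) are finite with N₀(x) > 0 for Lebesgue-a.e. x. Let R* = { x ∈ ℝⁿ : N_{θ₁}(x) > k · N₀(x) }. Then for every Lebesgue-measurable set R ⊆ ℝⁿ that is invariant under the location-scale transformations x ↦ (a + b·x₁, …, a + b·xₙ) for all a ∈ ℝ, b > 0, the inequality ∫_R ∏_{i=1}^n f(xᵢ;0) dx ≤ ∫_{R*} ∏_{i=1}^n f(xᵢ;0) dx implies ∫_R ∏_{i=1}^n f(xᵢ;θ₁) dx ≤ ∫_{R*} ∏_{i=1}^n f(xᵢ;θ₁) dx. -/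
open MeasureTheory
open scoped ENNReal

/-- The integrated likelihood `N_f(x) = ∫₀^∞ ∫ℝ ∏ᵢ f(a + b xᵢ) b^{n-2} da db`
(as a Lebesgue integral, so that finiteness is meaningful). -/
noncomputable def intLik (n : ℕ) (f : ℝ → ℝ) (x : Fin n → ℝ) : ℝ≥0∞ :=
  ∫⁻ b in Set.Ioi (0 : ℝ), ∫⁻ a : ℝ,
    (∏ i, ENNReal.ofReal (f (a + b * x i))) * ENNReal.ofReal (b ^ (n - 2))

/-- The likelihood of the i.i.d. sample `x` under the density `f`. -/
noncomputable def likelihood (n : ℕ) (f : ℝ → ℝ) (x : Fin n → ℝ) : ℝ≥0∞ :=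
  ∏ i, ENNReal.ofReal (f (x i))

/-- A weight whose integral over every location-scale orbit `{x | x i ≠ x j}` is one. -/
noncomputable def orbitWeight {n : ℕ} (i j : Fin n) (x : Fin n → ℝ) : ℝ≥0∞ :=
  (Set.Icc (0 : ℝ) 1).indicator 1 (x i) *
    (Set.Ici (1 : ℝ)).indicator (fun t => ENNReal.ofReal t⁻¹) |x j - x i|

@[fun_prop]
lemma measurable_likelihood {n : ℕ} {f : ℝ → ℝ} (hf : Measurable f) :
    Measurable (likelihood n f) := by
  unfold likelihood
  fun_prop

@[fun_prop]
lemma measurable_orbitWeight {n : ℕ} (i j : Fin n) : Measurable (orbitWeight i j) := by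
  have h₁ : Measurable ((Set.Icc (0 : ℝ) 1).indicator (1 : ℝ → ℝ≥0∞)) :=
    measurable_one.indicator measurableSet_Icc
  have h₂ : Measurable ((Set.Ici (1 : ℝ)).indicator (fun t => ENNReal.ofReal t⁻¹)) :=
    Measurable.indicator (by fun_prop) measurableSet_Ici
  unfold orbitWeight
  exact (h₁.comp (by fun_prop)).mul (h₂.comp (by fun_prop))

lemma lintegral_likelihood_ne_top (n : ℕ) {f : ℝ → ℝ} (hf : Measurable f) (hf0 : ∀ x, 0 ≤ f x)
    (hd : ∫⁻ x, ENNReal.ofReal (f x) ≠ ⊤) : ∫⁻ x, likelihood n f x ≠ ⊤ := by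
  have hint : Integrable f :=
    (lintegral_ofReal_ne_top_iff_integrable hf.aestronglyMeasurable (ae_of_all _ hf0)).1 hd
  have hprod : Integrable fun x : Fin n → ℝ => ∏ i, f (x i) :=
    Integrable.fintype_prod fun _ => hint
  simp_rw [likelihood, ← ENNReal.ofReal_prod_of_nonneg fun i _ => hf0 _]
  exact (lintegral_ofReal_ne_top_iff_integrable hprod.1
    (ae_of_all _ fun _ => Finset.prod_nonneg fun _ _ => hf0 _)).2 hprod

lemma lintegral_eq_mul_lintegral_smul {E : Type*} [NormedAddCommGroup E] [NormedSpace ℝ E]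
    [MeasurableSpace E] [BorelSpace E] [FiniteDimensional ℝ E] (μ : Measure E)
    [μ.IsAddHaarMeasure] (G : E → ℝ≥0∞) {b : ℝ} (hb : 0 < b) :
    ∫⁻ x, G x ∂μ = ENNReal.ofReal (b ^ Module.finrank ℝ E) * ∫⁻ x, G (b • x) ∂μ := by
  have h := (measurableEmbedding_const_smul₀ (α := E) hb.ne').lintegral_map (μ := μ) G
  rw [← h, Measure.map_addHaar_smul μ hb.ne', lintegral_smul_measure, smul_eq_mul, ← mul_assoc,
    ← ENNReal.ofReal_mul (by positivity), abs_of_pos (by positivity),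
    mul_inv_cancel₀ (by positivity), ENNReal.ofReal_one, one_mul]

lemma lintegral_eq_mul_lintegral_affine {n : ℕ} (G : (Fin n → ℝ) → ℝ≥0∞) (a : ℝ) {b : ℝ}
    (hb : 0 < b) :
    ∫⁻ x, G x = ENNReal.ofReal (b ^ n) * ∫⁻ x : Fin n → ℝ, G (fun i => a + b * x i) := by
  rw [← lintegral_add_left_eq_self G (fun _ => a), lintegral_eq_mul_lintegral_smul _ _ hb,
    Module.finrank_fin_fun]
  rfl

lemma measurable_intLik_integrand (n : ℕ) {f : ℝ → ℝ} (hf : Measurable f) :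
    Measurable (fun q : (Fin n → ℝ) × ℝ × ℝ =>
      likelihood n f (fun i => q.2.2 + q.2.1 * q.1 i) * ENNReal.ofReal (q.2.1 ^ (n - 2))) := by
  have := measurable_likelihood (n := n) hf
  exact (this.comp (by fun_prop)).mul (by fun_prop)

lemma intLik_eq_lintegral_prod (n : ℕ) {f : ℝ → ℝ} (hf : Measurable f) (x : Fin n → ℝ) :
    intLik n f x = ∫⁻ p, likelihood n f (fun i => p.2 + p.1 * x i) * ENNReal.ofReal (p.1 ^ (n - 2))
      ∂((volume.restrict (Set.Ioi (0 : ℝ))).prod (volume : Measure ℝ)) := by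
  rw [lintegral_prod]
  · rfl
  · exact ((measurable_intLik_integrand n hf).comp measurable_prodMk_left).aemeasurable

lemma measurable_intLik (n : ℕ) {f : ℝ → ℝ} (hf : Measurable f) : Measurable (intLik n f) := by
  simp_rw [funext (intLik_eq_lintegral_prod n hf)]
  exact (measurable_intLik_integrand n hf).lintegral_prod_right'

lemma intLik_affine {n : ℕ} (hn : 2 ≤ n) (f : ℝ → ℝ) (α : ℝ) {β : ℝ}
    (hβ : 0 < β) (x : Fin n → ℝ) :
    intLik n f x = ENNReal.ofReal (β ^ (n - 1)) * intLik n f (fun i => α + β * x i) := by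
  have hpow : ENNReal.ofReal (β ^ (n - 1)) = ENNReal.ofReal β * ENNReal.ofReal (β ^ (n - 2)) := by
    rw [← ENNReal.ofReal_mul hβ.le, ← pow_succ']
    congr 2
    lia
  unfold intLik
  simp_rw [← lintegral_indicator measurableSet_Ioi]
  rw [lintegral_eq_mul_lintegral_smul volume _ hβ, Module.finrank_self, pow_one, hpow, mul_assoc,
    ← lintegral_const_mul' (ENNReal.ofReal (β ^ (n - 2))) _ ENNReal.ofReal_ne_top]
  congr 1
  refine lintegral_congr fun b => ?_
  by_cases hb : 0 < b
  · rw [Set.indicator_of_mem (by simpa using mul_pos hβ hb), Set.indicator_of_mem (by simpa using hb),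
      ← lintegral_add_right_eq_self _ (b * α), ← lintegral_const_mul' _ _ ENNReal.ofReal_ne_top]
    congr 1 with a
    rw [smul_eq_mul, mul_pow, ENNReal.ofReal_mul (by positivity), mul_left_comm]
    congr 3 with i
    ring_nf
  · rw [Set.indicator_of_notMem (by simpa [hβ] using hb), Set.indicator_of_notMem (by simpa using hb),
      mul_zero]

lemma lintegral_orbitWeight {n : ℕ} (i j : Fin n) (x : Fin n → ℝ) (hx : x i ≠ x j) :
    ∫⁻ p, orbitWeight i j (fun l => p.1⁻¹ * (x l - p.2)) * ENNReal.ofReal (p.1 ^ 2)⁻¹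
      ∂((volume.restrict (Set.Ioi (0 : ℝ))).prod (volume : Measure ℝ)) = 1 := by
  have hΔ : 0 < |x j - x i| := abs_pos.2 (sub_ne_zero.2 hx.symm)
  have hw := measurable_orbitWeight i j
  rw [lintegral_prod _ (Measurable.aemeasurable (by fun_prop))]
  have key : ∀ b ∈ Set.Ioi (0 : ℝ),
      ∫⁻ a, orbitWeight i j (fun l => b⁻¹ * (x l - a)) * ENNReal.ofReal (b ^ 2)⁻¹ =
        (Set.Iic |x j - x i|).indicator (fun _ => ENNReal.ofReal |x j - x i|⁻¹) b := by
    intro b hb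
    have hb : 0 < b := hb
    have h : ∀ a, orbitWeight i j (fun l => b⁻¹ * (x l - a)) =
        (Set.Icc (x i - b) (x i)).indicator 1 a *
          (Set.Ici (1 : ℝ)).indicator (fun t => ENNReal.ofReal t⁻¹) (b⁻¹ * |x j - x i|) := by
      intro a
      have hmem : b⁻¹ * (x i - a) ∈ Set.Icc (0 : ℝ) 1 ↔ a ∈ Set.Icc (x i - b) (x i) := by
        rw [Set.mem_Icc, Set.mem_Icc, mul_nonneg_iff_of_pos_left (by positivity),
          inv_mul_le_iff₀ hb]
        constructor <;> rintro ⟨h₁, h₂⟩ <;> constructor <;> linarith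
      have habs : |b⁻¹ * (x j - a) - b⁻¹ * (x i - a)| = b⁻¹ * |x j - x i| := by
        rw [← mul_sub, abs_mul, abs_of_pos (by positivity)]
        congr 2
        ring
      simp only [orbitWeight, habs, Set.indicator_apply, hmem]
      rfl
    simp_rw [h, mul_assoc]
    rw [lintegral_mul_const _ (measurable_one.indicator measurableSet_Icc),
      lintegral_indicator_one measurableSet_Icc, Real.volume_Icc, sub_sub_cancel]
    have hiff : b⁻¹ * |x j - x i| ∈ Set.Ici (1 : ℝ) ↔ b ∈ Set.Iic |x j - x i| := by
      rw [Set.mem_Ici, Set.mem_Iic, le_inv_mul_iff₀ hb, mul_one]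
    simp only [Set.indicator_apply, hiff]
    split_ifs
    · rw [← ENNReal.ofReal_mul (by positivity), ← ENNReal.ofReal_mul (by positivity)]
      congr 1
      field_simp
    · simp
  rw [setLIntegral_congr_fun measurableSet_Ioi key, lintegral_indicator_const measurableSet_Iic,
    Measure.restrict_apply measurableSet_Iic, Set.inter_comm, Set.Ioi_inter_Iic, Real.volume_Ioc,
    ← ENNReal.ofReal_mul (by positivity), sub_zero, inv_mul_cancel₀ hΔ.ne', ENNReal.ofReal_one]

lemma ae_apply_ne_apply {n : ℕ} {i j : Fin n} (hij : i ≠ j) :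
    ∀ᵐ x : Fin n → ℝ, x i ≠ x j := by
  let s : Submodule ℝ (Fin n → ℝ) := LinearMap.ker
    (LinearMap.proj (R := ℝ) (φ := fun _ : Fin n => ℝ) i - LinearMap.proj j)
  have hs : s ≠ ⊤ := by
    intro h
    have : (Pi.single i 1 : Fin n → ℝ) ∈ s := h ▸ Submodule.mem_top
    simp [s, hij.symm] at this
  have h0 := Measure.addHaar_submodule volume s hs
  rw [ae_iff]
  convert h0 using 2
  ext x
  simp [s, sub_eq_zero]

/-- The probability of a location-scale invariant region is the integral over it of the
integrated likelihood against a fixed weight. -/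
lemma setLIntegral_likelihood_eq {n : ℕ} (hn : 2 ≤ n) {i j : Fin n} (hij : i ≠ j) {f : ℝ → ℝ}
    (hf : Measurable f) {R : Set (Fin n → ℝ)} (hR : MeasurableSet R)
    (hinv : ∀ a b : ℝ, 0 < b → ∀ x : Fin n → ℝ, x ∈ R ↔ (fun i => a + b * x i) ∈ R) :
    ∫⁻ x in R, likelihood n f x = ∫⁻ x in R, orbitWeight i j x * intLik n f x := by
  set ν := (volume.restrict (Set.Ioi (0 : ℝ))).prod (volume : Measure ℝ) with hν
  have hw := measurable_orbitWeight i j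
  have hL := measurable_likelihood (n := n) hf
  have hwm : Measurable (fun q : (Fin n → ℝ) × ℝ × ℝ =>
      orbitWeight i j (fun l => q.2.1⁻¹ * (q.1 l - q.2.2)) * ENNReal.ofReal (q.2.1 ^ 2)⁻¹) :=
    (hw.comp (by fun_prop)).mul (by fun_prop)
  have hpos : ∀ᵐ p ∂ν, 0 < p.1 :=
    Measure.quasiMeasurePreserving_fst.ae (ae_restrict_mem measurableSet_Ioi)
  calc ∫⁻ x in R, likelihood n f x
      = ∫⁻ x in R, ∫⁻ p, likelihood n f x * (orbitWeight i j (fun l => p.1⁻¹ * (x l - p.2)) *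
          ENNReal.ofReal (p.1 ^ 2)⁻¹) ∂ν := by
        refine lintegral_congr_ae (ae_restrict_of_ae ?_)
        filter_upwards [ae_apply_ne_apply hij] with x hx
        rw [lintegral_const_mul _ (by fun_prop), lintegral_orbitWeight i j x hx, mul_one]
    _ = ∫⁻ p, (∫⁻ x in R, likelihood n f x *
          (orbitWeight i j (fun l => p.1⁻¹ * (x l - p.2)) * ENNReal.ofReal (p.1 ^ 2)⁻¹)) ∂ν :=
        lintegral_lintegral_swap ((hL.comp measurable_fst).mul hwm).aemeasurable
    _ = ∫⁻ p, (∫⁻ x in R, orbitWeight i j x *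
          (likelihood n f (fun l => p.2 + p.1 * x l) * ENNReal.ofReal (p.1 ^ (n - 2)))) ∂ν := by
        refine lintegral_congr_ae ?_
        filter_upwards [hpos] with p hp
        rw [← lintegral_indicator hR, ← lintegral_indicator hR,
          lintegral_eq_mul_lintegral_affine _ p.2 hp,
          ← lintegral_const_mul' _ _ ENNReal.ofReal_ne_top]
        refine lintegral_congr fun x => ?_
        by_cases hx : x ∈ R
        · have hpow : ENNReal.ofReal (p.1 ^ n) * ENNReal.ofReal (p.1 ^ 2)⁻¹ =
              ENNReal.ofReal (p.1 ^ (n - 2)) := by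
            rw [← ENNReal.ofReal_mul (by positivity), pow_sub₀ _ hp.ne' hn]
          rw [Set.indicator_of_mem hx, Set.indicator_of_mem ((hinv _ _ hp x).1 hx)]
          simp only [add_sub_cancel_left, inv_mul_cancel_left₀ hp.ne', ← hpow]
          ring
        · rw [Set.indicator_of_notMem hx, Set.indicator_of_notMem ((hinv _ _ hp x).not.1 hx),
            mul_zero]
    _ = ∫⁻ x in R, ∫⁻ p, orbitWeight i j x * (likelihood n f (fun l => p.2 + p.1 * x l) *
          ENNReal.ofReal (p.1 ^ (n - 2))) ∂ν :=
        (lintegral_lintegral_swap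
          ((hw.comp measurable_fst).mul (measurable_intLik_integrand n hf)).aemeasurable).symm
    _ = ∫⁻ x in R, orbitWeight i j x * intLik n f x := by
        congr 1 with x
        rw [lintegral_const_mul _ (by fun_prop), intLik_eq_lintegral_prod n hf]

/-- The Neyman–Pearson lemma for regions, with integrands weighted by `w`. -/
lemma neyman_pearson {α : Type*} [MeasurableSpace α] {μ : Measure α} {w g₀ g₁ : α → ℝ≥0∞}
    {k : ℝ≥0∞} (hk : k ≠ ⊤) {R S : Set α} (hR : MeasurableSet R) (hS : MeasurableSet S)
    (hSg : ∀ x, x ∈ S ↔ k * g₀ x < g₁ x)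
    (hfin : ∫⁻ x in S, w x * g₀ x ∂μ ≠ ⊤)
    (hsize : ∫⁻ x in R, w x * g₀ x ∂μ ≤ ∫⁻ x in S, w x * g₀ x ∂μ) :
    ∫⁻ x in R, w x * g₁ x ∂μ ≤ ∫⁻ x in S, w x * g₁ x ∂μ := by
  have hdiff : ∫⁻ x in R \ S, w x * g₀ x ∂μ ≤ ∫⁻ x in S \ R, w x * g₀ x ∂μ := by
    rw [← lintegral_inter_add_sdiff _ R hS, ← lintegral_inter_add_sdiff _ S hR,
      Set.inter_comm S R] at hsize
    refine (ENNReal.add_le_add_iff_left (ne_top_of_le_ne_top hfin ?_)).1 hsize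
    exact lintegral_mono_set Set.inter_subset_right
  rw [← lintegral_inter_add_sdiff _ R hS, ← lintegral_inter_add_sdiff _ S hR, Set.inter_comm S R]
  gcongr 1
  calc ∫⁻ x in R \ S, w x * g₁ x ∂μ
      ≤ ∫⁻ x in R \ S, k * (w x * g₀ x) ∂μ := by
        refine setLIntegral_mono' (hR.diff hS) fun x hx => ?_
        rw [mul_left_comm]
        gcongr
        exact not_lt.1 fun h => hx.2 ((hSg x).2 h)
    _ = k * ∫⁻ x in R \ S, w x * g₀ x ∂μ := lintegral_const_mul' _ _ hk
    _ ≤ k * ∫⁻ x in S \ R, w x * g₀ x ∂μ := by gcongr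
    _ = ∫⁻ x in S \ R, k * (w x * g₀ x) ∂μ := (lintegral_const_mul' _ _ hk).symm
    _ ≤ ∫⁻ x in S \ R, w x * g₁ x ∂μ := by
        refine setLIntegral_mono' (hS.diff hR) fun x hx => ?_
        rw [mul_left_comm]
        gcongr
        exact ((hSg x).1 hx.1).le

/-- the region `R* = {x : N_{θ₁}(x) > k N₀(x)}` defined by the ratio of the
integrated likelihoods is the most powerful location-scale invariant test of `f₀` against `f₁`:
any invariant measurable region `R` whose size (null probability) does not exceed that of `R*`
also has power not exceeding that of `R*`. -/
theorem most_powerful_invariant_test (n : ℕ) (hn : 3 ≤ n) (θ₁ k : ℝ) (hθ₁ : 0 < θ₁)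
    (hk : 0 < k) (f0 f1 : ℝ → ℝ)
    (hf0m : Measurable f0) (hf1m : Measurable f1)
    (hf0nn : ∀ x, 0 ≤ f0 x) (hf1nn : ∀ x, 0 ≤ f1 x)
    (hf0d : (∫⁻ x : ℝ, ENNReal.ofReal (f0 x)) = 1)
    (hf1d : (∫⁻ x : ℝ, ENNReal.ofReal (f1 x)) = 1)
    (hfin : ∀ᵐ x : Fin n → ℝ,
      intLik n f0 x < ⊤ ∧ intLik n f1 x < ⊤ ∧ 0 < intLik n f0 x) :
    ∀ R : Set (Fin n → ℝ), MeasurableSet R →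
      (∀ (a b : ℝ), 0 < b → ∀ x : Fin n → ℝ, x ∈ R ↔ (fun i => a + b * x i) ∈ R) →
      (∫⁻ x in R, ∏ i, ENNReal.ofReal (f0 (x i))) ≤
        (∫⁻ x in {x : Fin n → ℝ | ENNReal.ofReal k * intLik n f0 x < intLik n f1 x},
          ∏ i, ENNReal.ofReal (f0 (x i))) →
      (∫⁻ x in R, ∏ i, ENNReal.ofReal (f1 (x i))) ≤
        (∫⁻ x in {x : Fin n → ℝ | ENNReal.ofReal k * intLik n f0 x < intLik n f1 x},
          ∏ i, ENNReal.ofReal (f1 (x i))) := by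
  intro R hR hinv hsize
  have hn2 : 2 ≤ n := by lia
  set S := {x : Fin n → ℝ | ENNReal.ofReal k * intLik n f0 x < intLik n f1 x} with hSdef
  have hS : MeasurableSet S :=
    measurableSet_lt ((measurable_intLik n hf0m).const_mul _) (measurable_intLik n hf1m)
  have hSinv : ∀ a b : ℝ, 0 < b → ∀ x : Fin n → ℝ, x ∈ S ↔ (fun i => a + b * x i) ∈ S := by
    intro a b hb x
    have hb' : ENNReal.ofReal (b ^ (n - 1)) ≠ 0 := by
      simpa using pow_pos hb (n - 1)
    simp only [hSdef, Set.mem_ofPred_eq]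
    rw [intLik_affine hn2 f0 a hb x, intLik_affine hn2 f1 a hb x, mul_left_comm,
      ENNReal.mul_lt_mul_iff_right hb' ENNReal.ofReal_ne_top]
  have hij : (⟨0, by lia⟩ : Fin n) ≠ ⟨1, by lia⟩ := by simp
  have hfinS : ∫⁻ x in S, likelihood n f0 x ≠ ⊤ := by
    refine ne_top_of_le_ne_top (lintegral_likelihood_ne_top n hf0m hf0nn ?_)
      (setLIntegral_le_lintegral _ _)
    simp [hf0d]
  change ∫⁻ x in R, likelihood n f0 x ≤ ∫⁻ x in S, likelihood n f0 x at hsize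
  change ∫⁻ x in R, likelihood n f1 x ≤ ∫⁻ x in S, likelihood n f1 x
  rw [setLIntegral_likelihood_eq hn2 hij hf0m hS hSinv] at hsize hfinS
  rw [setLIntegral_likelihood_eq hn2 hij hf0m hR hinv] at hsize
  rw [setLIntegral_likelihood_eq hn2 hij hf1m hR hinv,
    setLIntegral_likelihood_eq hn2 hij hf1m hS hSinv]
  exact neyman_pearson ENNReal.ofReal_ne_top hR hS (fun _ => Iff.rfl) hfinS hsize
end

section
/- There exist constants θ₀ ∈ (0,1), M > 0 and x₀ > 0 such that for all θ ∈ (0, θ₀] and all x ∈ ℝ with |x| ≥ x₀: | (1/π) ∫₀^∞ cos(tx) · t^{2−θ} · log t · exp(−t^{2−θ}) dt | ≤ M · |x|^{θ−3} · log|x|. That is, the θ-derivative of the symmetric stable density f(x;θ) = (1/π) ∫₀^∞ cos(tx) exp(−t^{2−θ}) dt satisfies |∂f(x;θ)/∂θ| ≤ M |x|^{θ−3} log|x| for |x| ≥ x₀, uniformly as θ = 2 − α ↓ 0. -/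
open MeasureTheory

/-- The `α`-derivative of `-exp (-t ^ α)`. -/
noncomputable def stableKernel (a t : ℝ) : ℝ :=
  (t ^ a * Real.log t) * Real.exp (-t ^ a)

/-- First derivative of `stableKernel a` on the positive half-line. -/
noncomputable def stableKernelDeriv (a t : ℝ) : ℝ :=
  (a * (t ^ a * Real.log t) + (-a) * ((t ^ a) ^ 2 * Real.log t) + 1 * t ^ a)
    * Real.exp (-t ^ a) / t

/-- Second derivative of `stableKernel a` on the positive half-line. -/
noncomputable def stableKernelDeriv₂ (a t : ℝ) : ℝ :=
  (a * (a - 1) * (t ^ a * Real.log t) + (a - 3 * a ^ 2) * ((t ^ a) ^ 2 * Real.log t)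
      + a ^ 2 * ((t ^ a) ^ 3 * Real.log t) + (2 * a - 1) * t ^ a + (-2 * a) * (t ^ a) ^ 2)
    * Real.exp (-t ^ a) / t ^ 2

/-- Third derivative of `stableKernel a` on the positive half-line. -/
noncomputable def stableKernelDeriv₃ (a t : ℝ) : ℝ :=
  (a * (a - 1) * (a - 2) * (t ^ a * Real.log t)
      + (-7 * a ^ 3 + 9 * a ^ 2 - 2 * a) * ((t ^ a) ^ 2 * Real.log t)
      + (6 * a ^ 3 - 3 * a ^ 2) * ((t ^ a) ^ 3 * Real.log t)
      + (-a ^ 3) * ((t ^ a) ^ 4 * Real.log t)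
      + (3 * a ^ 2 - 6 * a + 2) * t ^ a + (-9 * a ^ 2 + 6 * a) * (t ^ a) ^ 2
      + 3 * a ^ 2 * (t ^ a) ^ 3)
    * Real.exp (-t ^ a) / t ^ 3

lemma hasDerivAt_rpow_const_of_pos (a : ℝ) {t : ℝ} (ht : 0 < t) :
    HasDerivAt (fun s : ℝ => s ^ a) (a * t ^ a / t) t := by
  convert Real.hasDerivAt_rpow_const (p := a) (Or.inl ht.ne') using 1
  rw [Real.rpow_sub_one ht.ne']
  ring

lemma hasDerivAt_exp_neg_rpow (a : ℝ) {t : ℝ} (ht : 0 < t) :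
    HasDerivAt (fun s : ℝ => Real.exp (-s ^ a)) (Real.exp (-t ^ a) * -(a * t ^ a / t)) t :=
  (hasDerivAt_rpow_const_of_pos a ht).neg.exp

lemma hasDerivAt_stableKernel (a : ℝ) {t : ℝ} (ht : 0 < t) :
    HasDerivAt (stableKernel a) (stableKernelDeriv a t) t := by
  have hu := hasDerivAt_rpow_const_of_pos a ht
  have hE := hasDerivAt_exp_neg_rpow a ht
  have hL := Real.hasDerivAt_log ht.ne'
  refine ((hu.mul hL).mul hE).congr_deriv ?_
  simp only [stableKernelDeriv, Pi.mul_apply]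
  field_simp
  ring

lemma hasDerivAt_stableKernelDeriv (a : ℝ) {t : ℝ} (ht : 0 < t) :
    HasDerivAt (stableKernelDeriv a) (stableKernelDeriv₂ a t) t := by
  have hu := hasDerivAt_rpow_const_of_pos a ht
  have hE := hasDerivAt_exp_neg_rpow a ht
  have hL := Real.hasDerivAt_log ht.ne'
  refine (((((hu.mul hL).const_mul a).add (((hu.fun_pow 2).mul hL).const_mul (-a))).add
    (hu.const_mul 1)).mul hE |>.div (hasDerivAt_id t) ht.ne').congr_deriv ?_
  simp only [stableKernelDeriv₂, id, Pi.add_apply, Pi.mul_apply]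
  field_simp
  ring

lemma hasDerivAt_stableKernelDeriv₂ (a : ℝ) {t : ℝ} (ht : 0 < t) :
    HasDerivAt (stableKernelDeriv₂ a) (stableKernelDeriv₃ a t) t := by
  have hu := hasDerivAt_rpow_const_of_pos a ht
  have hE := hasDerivAt_exp_neg_rpow a ht
  have hL := Real.hasDerivAt_log ht.ne'
  refine (((((((hu.mul hL).const_mul (a * (a - 1))).add
    (((hu.fun_pow 2).mul hL).const_mul (a - 3 * a ^ 2))).add
    (((hu.fun_pow 3).mul hL).const_mul (a ^ 2))).add
    (hu.const_mul (2 * a - 1))).add ((hu.fun_pow 2).const_mul (-2 * a))).mul hE |>.div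
    (hasDerivAt_pow 2 t) (pow_ne_zero 2 ht.ne')).congr_deriv ?_
  simp only [stableKernelDeriv₃, Pi.add_apply, Pi.mul_apply]
  field_simp
  ring

lemma abs_mul_le_mul {c m K B : ℝ} (hc : |c| ≤ K) (hm : |m| ≤ B) : |c * m| ≤ K * B := by
  rw [abs_mul]
  exact mul_le_mul hc hm (abs_nonneg m) ((abs_nonneg c).trans hc)

lemma abs_mul_exp_div_le {n v d B : ℝ} (hn : |n| ≤ B) (hd : 0 < d) :
    |n * Real.exp v / d| ≤ B * Real.exp v / d := by
  rw [abs_div, abs_mul, abs_of_pos hd, Real.abs_exp]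
  gcongr

section Coefficients

variable {a : ℝ}

lemma abs_mul_sub_one_mul_sub_two_le (h1 : 3 / 2 ≤ a) (h2 : a < 2) :
    |a * (a - 1) * (a - 2)| ≤ 2 * (2 - a) := by
  rw [abs_mul, abs_of_neg (by linarith : a - 2 < 0), abs_of_nonneg (by nlinarith)]
  nlinarith [mul_nonneg (by linarith : 0 ≤ 2 - a) (by nlinarith : 0 ≤ 2 - a * (a - 1))]

lemma abs_cubic_log_sq_coeff_le (h1 : 3 / 2 ≤ a) (h2 : a < 2) :
    |-7 * a ^ 3 + 9 * a ^ 2 - 2 * a| ≤ 96 := by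
  have h3 : a ^ 2 ≤ 4 := by nlinarith
  have h4 : a ^ 3 ≤ 8 := by nlinarith
  have h5 : 0 ≤ a ^ 2 := by positivity
  have h6 : 0 ≤ a ^ 3 := by nlinarith
  rw [abs_le]; constructor <;> linarith

lemma abs_cubic_log_cube_coeff_le (h1 : 3 / 2 ≤ a) (h2 : a < 2) :
    |6 * a ^ 3 - 3 * a ^ 2| ≤ 60 := by
  have h3 : a ^ 2 ≤ 4 := by nlinarith
  have h4 : a ^ 3 ≤ 8 := by nlinarith
  have h5 : 0 ≤ a ^ 2 := by positivity
  have h6 : 0 ≤ a ^ 3 := by nlinarith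
  rw [abs_le]; constructor <;> linarith

lemma abs_neg_cube_le (h1 : 3 / 2 ≤ a) (h2 : a < 2) : |-a ^ 3| ≤ 8 := by
  have h3 : a ^ 2 ≤ 4 := by nlinarith
  have h4 : a ^ 3 ≤ 8 := by nlinarith
  have h6 : 0 ≤ a ^ 3 := by nlinarith
  rw [abs_le]; constructor <;> linarith

lemma abs_quadratic_coeff_le (h1 : 3 / 2 ≤ a) (h2 : a < 2) : |3 * a ^ 2 - 6 * a + 2| ≤ 26 := by
  rw [abs_le]; constructor <;> nlinarith

lemma abs_quadratic_sq_coeff_le (h1 : 3 / 2 ≤ a) (h2 : a < 2) : |-9 * a ^ 2 + 6 * a| ≤ 48 := by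
  rw [abs_le]; constructor <;> nlinarith

lemma abs_three_mul_sq_le (h1 : 3 / 2 ≤ a) (h2 : a < 2) : |3 * a ^ 2| ≤ 12 := by
  rw [abs_le]; constructor <;> nlinarith

lemma abs_sub_three_mul_sq_le (h1 : 3 / 2 ≤ a) (h2 : a < 2) : |a - 3 * a ^ 2| ≤ 10 := by
  rw [abs_le]; constructor <;> nlinarith

lemma abs_stableKernelDeriv_le {t B : ℝ} (h1 : 3 / 2 ≤ a) (h2 : a < 2) (ht : 0 < t)
    (hB₁ : |t ^ a * Real.log t| ≤ B) (hB₂ : |(t ^ a) ^ 2 * Real.log t| ≤ B) (hB₃ : |t ^ a| ≤ B) :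
    |stableKernelDeriv a t| ≤ 5 * B * Real.exp (-t ^ a) / t := by
  refine abs_mul_exp_div_le ?_ ht
  have k1 := abs_mul_le_mul (show |a| ≤ 2 by rw [abs_le]; constructor <;> linarith) hB₁
  have k2 := abs_mul_le_mul (show |-a| ≤ 2 by rw [abs_le]; constructor <;> linarith) hB₂
  have k3 := abs_mul_le_mul (show |(1 : ℝ)| ≤ 1 by simp) hB₃
  rw [abs_le] at *
  constructor <;> linarith

lemma abs_stableKernelDeriv₂_le {t B : ℝ} (h1 : 3 / 2 ≤ a) (h2 : a < 2) (ht : 0 < t)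
    (hB₁ : |t ^ a * Real.log t| ≤ B) (hB₂ : |(t ^ a) ^ 2 * Real.log t| ≤ B)
    (hB₃ : |(t ^ a) ^ 3 * Real.log t| ≤ B) (hB₄ : |t ^ a| ≤ B) (hB₅ : |(t ^ a) ^ 2| ≤ B) :
    |stableKernelDeriv₂ a t| ≤ 23 * B * Real.exp (-t ^ a) / t ^ 2 := by
  refine abs_mul_exp_div_le ?_ (by positivity)
  have k1 := abs_mul_le_mul
    (show |a * (a - 1)| ≤ 2 by rw [abs_le]; constructor <;> nlinarith) hB₁
  have k2 := abs_mul_le_mul (abs_sub_three_mul_sq_le h1 h2) hB₂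
  have k3 := abs_mul_le_mul (show |a ^ 2| ≤ 4 by rw [abs_le]; constructor <;> nlinarith) hB₃
  have k4 := abs_mul_le_mul (show |2 * a - 1| ≤ 3 by rw [abs_le]; constructor <;> linarith) hB₄
  have k5 := abs_mul_le_mul (show |-2 * a| ≤ 4 by rw [abs_le]; constructor <;> linarith) hB₅
  rw [abs_le] at *
  constructor <;> linarith

lemma abs_stableKernelDeriv₃_le {t B B' B'' : ℝ} (h1 : 3 / 2 ≤ a) (h2 : a < 2) (ht : 0 < t)
    (hB₁ : |t ^ a * Real.log t| ≤ B) (hB₂ : |t ^ a| ≤ B')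
    (hB₃ : |(t ^ a) ^ 2 * Real.log t| ≤ B'') (hB₄ : |(t ^ a) ^ 3 * Real.log t| ≤ B'')
    (hB₅ : |(t ^ a) ^ 4 * Real.log t| ≤ B'') (hB₆ : |(t ^ a) ^ 2| ≤ B'')
    (hB₇ : |(t ^ a) ^ 3| ≤ B'') :
    |stableKernelDeriv₃ a t|
      ≤ (2 * (2 - a) * B + 26 * B' + 224 * B'') * Real.exp (-t ^ a) / t ^ 3 := by
  refine abs_mul_exp_div_le ?_ (by positivity)
  have k1 := abs_mul_le_mul (abs_mul_sub_one_mul_sub_two_le h1 h2) hB₁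
  have k2 := abs_mul_le_mul (abs_cubic_log_sq_coeff_le h1 h2) hB₃
  have k3 := abs_mul_le_mul (abs_cubic_log_cube_coeff_le h1 h2) hB₄
  have k4 := abs_mul_le_mul (abs_neg_cube_le h1 h2) hB₅
  have k5 := abs_mul_le_mul (abs_quadratic_coeff_le h1 h2) hB₂
  have k6 := abs_mul_le_mul (abs_quadratic_sq_coeff_le h1 h2) hB₆
  have k7 := abs_mul_le_mul (abs_three_mul_sq_le h1 h2) hB₇
  generalize t ^ a = u at *
  generalize Real.log t = L at *
  rw [abs_le] at k1 k2 k3 k4 k5 k6 k7 ⊢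
  constructor
  · linarith only [k1.1, k2.1, k3.1, k4.1, k5.1, k6.1, k7.1]
  · linarith only [k1.2, k2.2, k3.2, k4.2, k5.2, k6.2, k7.2]

end Coefficients

lemma pow_mul_exp_neg_le {u : ℝ} (hu : 0 ≤ u) (n : ℕ) :
    u ^ n * Real.exp (-u) ≤ n.factorial := by
  have h := Real.pow_div_factorial_le_exp u hu n
  rw [div_le_iff₀ (by positivity)] at h
  rw [Real.exp_neg, ← div_eq_mul_inv, div_le_iff₀ (Real.exp_pos u), mul_comm]
  exact h

section Large

variable {a t : ℝ}

lemma le_rpow_of_one_le (h1 : 3 / 2 ≤ a) (ht : 1 ≤ t) : t ≤ t ^ a := by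
  simpa using Real.rpow_le_rpow_of_exponent_le ht (by linarith : 1 ≤ a)

lemma abs_rpow_pow_mul_log_le (h1 : 3 / 2 ≤ a) (ht : 1 ≤ t) {k : ℕ} (hk : k ≤ 4) :
    |(t ^ a) ^ k * Real.log t| ≤ (t ^ a) ^ 4 * t := by
  have hu := ht.trans (le_rpow_of_one_le h1 ht)
  refine (abs_mul _ _).trans_le ?_
  rw [abs_of_nonneg (by positivity : 0 ≤ (t ^ a) ^ k), abs_of_nonneg (Real.log_nonneg ht)]
  gcongr
  · exact Real.log_nonneg ht
  · exact Real.log_le_self (by linarith)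

lemma abs_rpow_pow_le (h1 : 3 / 2 ≤ a) (ht : 1 ≤ t) {k : ℕ} (hk : k ≤ 4) :
    |(t ^ a) ^ k| ≤ (t ^ a) ^ 4 * t := by
  have hu := ht.trans (le_rpow_of_one_le h1 ht)
  rw [abs_of_nonneg (by positivity)]
  exact (pow_le_pow_right₀ hu hk).trans (le_mul_of_one_le_right (by positivity) ht)

lemma rpow_pow_mul_self_mul_exp_le (h1 : 3 / 2 ≤ a) (ht : 1 ≤ t) :
    (t ^ a) ^ 4 * t * Real.exp (-t ^ a) ≤ 720 / t := by
  have hu := le_rpow_of_one_le h1 ht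
  have h0 : 0 < t := by linarith
  rw [le_div_iff₀ h0]
  calc (t ^ a) ^ 4 * t * Real.exp (-t ^ a) * t
      = (t ^ a) ^ 4 * (t * t) * Real.exp (-t ^ a) := by ring
    _ ≤ (t ^ a) ^ 4 * (t ^ a * t ^ a) * Real.exp (-t ^ a) := by gcongr
    _ = (t ^ a) ^ 6 * Real.exp (-t ^ a) := by ring
    _ ≤ (Nat.factorial 6 : ℕ) := pow_mul_exp_neg_le (by linarith) 6
    _ = 720 := by norm_num [Nat.factorial]

lemma abs_stableKernel_le_of_one_le (h1 : 3 / 2 ≤ a) (ht : 1 ≤ t) :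
    |stableKernel a t| ≤ 720 / t := by
  have h := abs_rpow_pow_mul_log_le h1 ht (k := 1) (by norm_num)
  rw [pow_one] at h
  rw [stableKernel, abs_mul, Real.abs_exp]
  exact (mul_le_mul_of_nonneg_right h (Real.exp_pos _).le).trans
    (rpow_pow_mul_self_mul_exp_le h1 ht)

lemma abs_stableKernelDeriv_le_of_one_le (h1 : 3 / 2 ≤ a) (h2 : a < 2) (ht : 1 ≤ t) :
    |stableKernelDeriv a t| ≤ 5 * (720 / t) := by
  have h := abs_rpow_pow_mul_log_le h1 ht (k := 1) (by norm_num)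
  have h' := abs_rpow_pow_le h1 ht (k := 1) (by norm_num)
  rw [pow_one] at h h'
  refine (abs_stableKernelDeriv_le h1 h2 (by linarith) h
    (abs_rpow_pow_mul_log_le h1 ht (by norm_num)) h').trans ?_
  have h0 : 0 < t := by linarith
  refine (div_le_self (by positivity) ht).trans ?_
  linarith [rpow_pow_mul_self_mul_exp_le h1 ht]

lemma abs_stableKernelDeriv₂_le_of_one_le (h1 : 3 / 2 ≤ a) (h2 : a < 2) (ht : 1 ≤ t) :
    |stableKernelDeriv₂ a t| ≤ 23 * (720 / t) := by
  have h := abs_rpow_pow_mul_log_le h1 ht (k := 1) (by norm_num)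
  have h' := abs_rpow_pow_le h1 ht (k := 1) (by norm_num)
  rw [pow_one] at h h'
  refine (abs_stableKernelDeriv₂_le h1 h2 (by linarith) h
    (abs_rpow_pow_mul_log_le h1 ht (by norm_num)) (abs_rpow_pow_mul_log_le h1 ht (by norm_num))
    h' (abs_rpow_pow_le h1 ht (by norm_num))).trans ?_
  have h0 : 0 < t := by linarith
  refine (div_le_self (by positivity) (one_le_pow₀ ht)).trans ?_
  linarith [rpow_pow_mul_self_mul_exp_le h1 ht]

lemma abs_stableKernelDeriv₃_le_of_one_le (h1 : 3 / 2 ≤ a) (h2 : a < 2) (ht : 1 ≤ t) :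
    |stableKernelDeriv₃ a t| ≤ 6096 * t ^ (-2 : ℝ) := by
  have h := abs_rpow_pow_mul_log_le h1 ht (k := 1) (by norm_num)
  have h' := abs_rpow_pow_le h1 ht (k := 1) (by norm_num)
  rw [pow_one] at h h'
  have h0 : 0 < t := by linarith
  refine (abs_stableKernelDeriv₃_le h1 h2 h0 h h'
    (abs_rpow_pow_mul_log_le h1 ht (by norm_num)) (abs_rpow_pow_mul_log_le h1 ht (by norm_num))
    (abs_rpow_pow_mul_log_le h1 ht (by norm_num)) (abs_rpow_pow_le h1 ht (by norm_num))
    (abs_rpow_pow_le h1 ht (by norm_num))).trans ?_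
  have h3 : (t ^ a) ^ 4 * Real.exp (-t ^ a) ≤ 24 := by
    simpa [Nat.factorial] using pow_mul_exp_neg_le (by positivity : 0 ≤ t ^ a) 4
  have h4 : t ^ (-2 : ℝ) = 1 / t ^ 2 := by
    rw [Real.rpow_neg h0.le]
    norm_num
  rw [h4, mul_one_div, div_le_div_iff₀ (by positivity) (by positivity)]
  calc _ = (2 * (2 - a) + 250) * ((t ^ a) ^ 4 * Real.exp (-t ^ a)) * t ^ 3 := by ring
    _ ≤ 254 * 24 * t ^ 3 := by
      gcongr
      linarith
    _ = _ := by ring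

end Large

section Small

variable {a b t : ℝ}

lemma abs_log_le_of_mem (hb : 0 < b) (hbt : b ≤ t) (ht : t ≤ 1) :
    |Real.log t| ≤ -Real.log b := by
  rw [abs_of_nonpos (Real.log_nonpos (by linarith) ht)]
  exact neg_le_neg (Real.log_le_log hb hbt)

lemma abs_rpow_pow_mul_log_le_of_le_one (h1 : 3 / 2 ≤ a) (hb : 0 < b) (hbt : b ≤ t)
    (ht : t ≤ 1) {j k : ℕ} (hk : j ≤ k) :
    |(t ^ a) ^ k * Real.log t| ≤ (t ^ a) ^ j * -Real.log b := by
  have h0 : 0 < t := by linarith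
  refine (abs_mul _ _).trans_le ?_
  rw [abs_of_nonneg (by positivity)]
  exact mul_le_mul (pow_le_pow_of_le_one (by positivity)
    (Real.rpow_le_one h0.le ht (by linarith)) hk) (abs_log_le_of_mem hb hbt ht) (abs_nonneg _)
    (by positivity)

lemma abs_rpow_pow_le_of_le_one (h1 : 3 / 2 ≤ a) (h0 : 0 < t) (ht : t ≤ 1)
    {l : ℝ} (hl : 1 ≤ l) {j k : ℕ} (hk : j ≤ k) :
    |(t ^ a) ^ k| ≤ (t ^ a) ^ j * l := by
  rw [abs_of_nonneg (by positivity)]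
  exact (pow_le_pow_of_le_one (by positivity)
    (Real.rpow_le_one h0.le ht (by linarith)) hk).trans
    (le_mul_of_one_le_right (by positivity) hl)

lemma abs_stableKernel_le_of_le_one (h1 : 3 / 2 ≤ a) (hb : 0 < b) (hb1 : b ≤ 1) :
    |stableKernel a b| ≤ b ^ a * -Real.log b := by
  have h := abs_rpow_pow_mul_log_le_of_le_one h1 hb le_rfl hb1 (le_refl 1)
  simp only [pow_one] at h
  rw [stableKernel, abs_mul, Real.abs_exp]
  refine (mul_le_of_le_one_right (abs_nonneg _) (Real.exp_le_one_iff.2 ?_)).trans h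
  simp only [Left.neg_nonpos_iff]
  positivity

lemma mul_exp_neg_rpow_le_self (hb : 0 ≤ b) {B : ℝ} (hB : 0 ≤ B) :
    B * Real.exp (-b ^ a) ≤ B :=
  mul_le_of_le_one_right hB (Real.exp_le_one_iff.2 (neg_nonpos.2 (Real.rpow_nonneg hb a)))

lemma abs_stableKernelDeriv_le_of_le_one (h1 : 3 / 2 ≤ a) (h2 : a < 2) (hb : 0 < b)
    (hb1 : b ≤ 1) (hl : 1 ≤ -Real.log b) :
    |stableKernelDeriv a b| ≤ 5 * (b ^ a * -Real.log b) / b := by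
  have h := @abs_rpow_pow_mul_log_le_of_le_one a b b h1 hb le_rfl hb1 1
  have h' := @abs_rpow_pow_le_of_le_one a b h1 hb hb1 _ hl 1
  have k := @h 1 le_rfl
  have k' := @h' 1 le_rfl
  simp only [pow_one] at h h' k k'
  refine (abs_stableKernelDeriv_le h1 h2 hb k (h (by norm_num)) k').trans ?_
  exact div_le_div_of_nonneg_right (mul_exp_neg_rpow_le_self hb.le (by positivity))
    (by positivity)

lemma abs_stableKernelDeriv₂_le_of_le_one (h1 : 3 / 2 ≤ a) (h2 : a < 2) (hb : 0 < b)
    (hb1 : b ≤ 1) (hl : 1 ≤ -Real.log b) :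
    |stableKernelDeriv₂ a b| ≤ 23 * (b ^ a * -Real.log b) / b ^ 2 := by
  have h := @abs_rpow_pow_mul_log_le_of_le_one a b b h1 hb le_rfl hb1 1
  have h' := @abs_rpow_pow_le_of_le_one a b h1 hb hb1 _ hl 1
  have k := @h 1 le_rfl
  have k' := @h' 1 le_rfl
  simp only [pow_one] at h h' k k'
  refine (abs_stableKernelDeriv₂_le h1 h2 hb k (h (by norm_num)) (h (by norm_num)) k'
    (h' (by norm_num))).trans ?_
  exact div_le_div_of_nonneg_right (mul_exp_neg_rpow_le_self hb.le (by positivity))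
    (by positivity)

lemma abs_stableKernelDeriv₃_le_of_le_one (h1 : 3 / 2 ≤ a) (h2 : a < 2) (hb : 0 < b)
    (hbt : b ≤ t) (ht : t ≤ 1) (hl : 1 ≤ -Real.log b) :
    |stableKernelDeriv₃ a t| ≤ 2 * -Real.log b * ((2 - a) * t ^ (a - 3))
      + 26 * b ^ (a - 2) * t⁻¹ + 224 * -Real.log b := by
  have h0 : 0 < t := by linarith
  have h := @abs_rpow_pow_mul_log_le_of_le_one a b t h1 hb hbt ht
  have h' := @abs_rpow_pow_le_of_le_one a t h1 h0 ht _ hl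
  have k := @h 1 1 le_rfl
  have k' : |t ^ a| ≤ t ^ a := (abs_of_nonneg (by positivity)).le
  simp only [pow_one] at k
  refine (abs_stableKernelDeriv₃_le h1 h2 h0 k k' (@h 2 2 le_rfl) (@h 2 3 (by norm_num))
    (@h 2 4 (by norm_num)) (@h' 2 2 le_rfl) (@h' 2 3 (by norm_num))).trans ?_
  have ha : 0 ≤ 2 - a := by linarith
  have e1 : t ^ (a - 3) = t ^ a / t ^ 3 := by
    rw [Real.rpow_sub h0]; norm_cast
  have e2 : t ^ a / t ^ 3 ≤ b ^ (a - 2) * t⁻¹ := by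
    have : t ^ a / t ^ 3 = t ^ (a - 2) * t⁻¹ := by
      rw [Real.rpow_sub h0, show t ^ (2 : ℝ) = t ^ 2 by norm_cast]
      field_simp
    rw [this]
    gcongr ?_ * _
    exact Real.rpow_le_rpow_of_nonpos hb hbt (by linarith)
  have e3 : (t ^ a) ^ 2 / t ^ 3 ≤ 1 := by
    rw [div_le_one (by positivity), ← Real.rpow_mul_natCast h0.le, ← Real.rpow_natCast t 3]
    refine Real.rpow_le_rpow_of_exponent_ge h0 ht ?_
    push_cast
    linarith
  calc _ ≤ (2 * (2 - a) * (t ^ a * -Real.log b) + 26 * t ^ a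
        + 224 * ((t ^ a) ^ 2 * -Real.log b)) / t ^ 3 := by
        gcongr
        exact mul_exp_neg_rpow_le_self h0.le (by positivity)
    _ = 2 * -Real.log b * ((2 - a) * (t ^ a / t ^ 3)) + 26 * (t ^ a / t ^ 3)
        + 224 * -Real.log b * ((t ^ a) ^ 2 / t ^ 3) := by ring
    _ ≤ 2 * -Real.log b * ((2 - a) * (t ^ a / t ^ 3)) + 26 * (b ^ (a - 2) * t⁻¹)
        + 224 * -Real.log b * 1 := by gcongr
    _ = _ := by rw [e1]; ring

end Small

section Tail

variable {a b : ℝ}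

lemma continuousOn_stableKernelDeriv₃ (hb : 0 < b) :
    ContinuousOn (stableKernelDeriv₃ a) (Set.Ici b) := by
  intro t ht
  have h0 : t ≠ 0 := (hb.trans_le ht).ne'
  have hu : ContinuousAt (fun s : ℝ => s ^ a) t := Real.continuousAt_rpow_const t a (Or.inl h0)
  have hL : ContinuousAt Real.log t := Real.continuousAt_log h0
  refine ContinuousAt.continuousWithinAt ?_
  unfold stableKernelDeriv₃
  exact ContinuousAt.div (by fun_prop) (by fun_prop) (pow_ne_zero 3 h0)

lemma integral_majorant_le (h2 : a < 2) (hb : 0 < b) (hb1 : b ≤ 1) (hl : 1 ≤ -Real.log b) :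
    IntervalIntegrable (fun t => 2 * -Real.log b * ((2 - a) * t ^ (a - 3))
      + 26 * b ^ (a - 2) * t⁻¹ + 224 * -Real.log b) volume b 1 ∧
    ∫ t in b..1, (2 * -Real.log b * ((2 - a) * t ^ (a - 3))
      + 26 * b ^ (a - 2) * t⁻¹ + 224 * -Real.log b) ≤ 252 * (b ^ (a - 2) * -Real.log b) := by
  have hpos : ∀ t ∈ Set.uIcc b 1, t ≠ 0 := fun t ht => by
    rw [Set.uIcc_of_le hb1] at ht
    exact (hb.trans_le ht.1).ne'
  have hfi : IntervalIntegrable (fun t => 2 * -Real.log b * ((2 - a) * t ^ (a - 3))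
      + 26 * b ^ (a - 2) * t⁻¹ + 224 * -Real.log b) volume b 1 := by
    refine ContinuousOn.intervalIntegrable fun t ht => ContinuousAt.continuousWithinAt ?_
    have hu := Real.continuousAt_rpow_const t (a - 3) (Or.inl (hpos t ht))
    have hi := continuousAt_inv₀ (hpos t ht)
    fun_prop
  refine ⟨hfi, ?_⟩
  rw [intervalIntegral.integral_eq_sub_of_hasDerivAt
    (f := fun t => 2 * -Real.log b * (-t ^ (a - 2)) + 26 * b ^ (a - 2) * Real.log t
      + 224 * -Real.log b * t) (fun t ht => ?_) hfi]
  · have hW : 1 ≤ b ^ (a - 2) := Real.one_le_rpow_of_pos_of_le_one_of_nonpos hb hb1 (by linarith)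
    simp only [Real.one_rpow, Real.log_one]
    nlinarith [mul_nonneg (by linarith : 0 ≤ -Real.log b) hb.le,
      mul_le_mul_of_nonneg_left hW (by linarith : 0 ≤ -Real.log b)]
  · have hu := Real.hasDerivAt_rpow_const (p := a - 2) (Or.inl (hpos t ht))
    rw [show a - 2 - 1 = a - 3 by ring] at hu
    refine (((hu.neg.const_mul (2 * -Real.log b)).add
      ((Real.hasDerivAt_log (hpos t ht)).const_mul (26 * b ^ (a - 2)))).add
      ((hasDerivAt_id t).const_mul (224 * -Real.log b))).congr_deriv ?_
    ring

lemma integral_abs_stableKernelDeriv₃_le (h1 : 3 / 2 ≤ a) (h2 : a < 2) (hb : 0 < b)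
    (hb1 : b ≤ 1) (hl : 1 ≤ -Real.log b) :
    IntegrableOn (stableKernelDeriv₃ a) (Set.Ioi b) ∧
      ∫ t in Set.Ioi b, |stableKernelDeriv₃ a t| ≤ 6348 * (b ^ (a - 2) * -Real.log b) := by
  obtain ⟨hm, hmle⟩ := integral_majorant_le h2 hb hb1 hl
  rw [intervalIntegrable_iff_integrableOn_Ioc_of_le hb1] at hm
  rw [intervalIntegral.integral_of_le hb1] at hmle
  have hn : IntegrableOn (fun t : ℝ => 6096 * t ^ (-2 : ℝ)) (Set.Ioi 1) :=
    (integrableOn_Ioi_rpow_of_lt (by norm_num) one_pos).const_mul _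
  have hnle : ∫ t in Set.Ioi (1 : ℝ), 6096 * t ^ (-2 : ℝ) = 6096 := by
    rw [integral_const_mul, integral_Ioi_rpow_of_lt (by norm_num) one_pos]
    norm_num
  have hbd₁ : ∀ t ∈ Set.Ioc b 1, |stableKernelDeriv₃ a t| ≤ _ := fun t ht =>
    abs_stableKernelDeriv₃_le_of_le_one h1 h2 hb ht.1.le ht.2 hl
  have hbd₂ : ∀ t ∈ Set.Ioi (1 : ℝ), |stableKernelDeriv₃ a t| ≤ _ := fun t ht =>
    abs_stableKernelDeriv₃_le_of_one_le h1 h2 (le_of_lt ht)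
  have hc := continuousOn_stableKernelDeriv₃ (a := a) hb
  have hi₁ : IntegrableOn (stableKernelDeriv₃ a) (Set.Ioc b 1) :=
    hm.mono' ((hc.mono fun t ht => ht.1.le).aestronglyMeasurable measurableSet_Ioc)
      (ae_restrict_of_forall_mem measurableSet_Ioc hbd₁)
  have hi₂ : IntegrableOn (stableKernelDeriv₃ a) (Set.Ioi 1) :=
    hn.mono' ((hc.mono fun t ht => hb1.trans (le_of_lt ht)).aestronglyMeasurable
      measurableSet_Ioi) (ae_restrict_of_forall_mem measurableSet_Ioi hbd₂)
  have hW : 1 ≤ b ^ (a - 2) := Real.one_le_rpow_of_pos_of_le_one_of_nonpos hb hb1 (by linarith)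
  rw [← Set.Ioc_union_Ioi_eq_Ioi hb1]
  refine ⟨hi₁.union hi₂, ?_⟩
  rw [setIntegral_union Set.Ioc_disjoint_Ioi_same measurableSet_Ioi hi₁.abs hi₂.abs]
  have k1 := setIntegral_mono_on hi₁.abs hm measurableSet_Ioc hbd₁
  have k2 := setIntegral_mono_on hi₂.abs hn measurableSet_Ioi hbd₂
  rw [hnle] at k2
  have k3 := one_le_mul_of_one_le_of_one_le hW hl
  linarith

/-- An antiderivative of `cos (t / b) * stableKernel a t`, up to a third-order remainder. -/
noncomputable def stablePrimitive (a b t : ℝ) : ℝ :=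
  Real.sin (t * b⁻¹) * (b * stableKernel a t) + Real.cos (t * b⁻¹) * (b ^ 2 * stableKernelDeriv a t)
    - Real.sin (t * b⁻¹) * (b ^ 3 * stableKernelDeriv₂ a t)

lemma hasDerivAt_stablePrimitive (hb : 0 < b) {t : ℝ} (ht : 0 < t) :
    HasDerivAt (stablePrimitive a b) (Real.cos (t * b⁻¹) * stableKernel a t
      - b ^ 3 * (Real.sin (t * b⁻¹) * stableKernelDeriv₃ a t)) t := by
  have h0 := (hasDerivAt_stableKernel a ht).const_mul b
  have h1 := (hasDerivAt_stableKernelDeriv a ht).const_mul (b ^ 2)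
  have h2 := (hasDerivAt_stableKernelDeriv₂ a ht).const_mul (b ^ 3)
  have hx := (hasDerivAt_id t).mul_const b⁻¹
  refine (((hx.sin.mul h0).add (hx.cos.mul h1)).sub (hx.sin.mul h2)).congr_deriv ?_
  simp only [id]
  field_simp
  ring

lemma abs_stablePrimitive_le (hb : 0 < b) (t : ℝ) :
    |stablePrimitive a b t| ≤ b * |stableKernel a t| + b ^ 2 * |stableKernelDeriv a t|
      + b ^ 3 * |stableKernelDeriv₂ a t| := by
  have e : ∀ {s c y : ℝ}, |s| ≤ 1 → 0 < c → |s * (c * y)| ≤ c * |y| := fun {s c y} hs hc => by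
    have := abs_mul_le_mul hs (le_refl |c * y|)
    rwa [one_mul, abs_mul c, abs_of_pos hc] at this
  exact (abs_sub _ _).trans (add_le_add ((abs_add_le _ _).trans (add_le_add
    (e (Real.abs_sin_le_one _) hb) (e (Real.abs_cos_le_one _) (by positivity))))
    (e (Real.abs_sin_le_one _) (by positivity)))

lemma tendsto_stablePrimitive (h1 : 3 / 2 ≤ a) (h2 : a < 2) (hb : 0 < b) :
    Filter.Tendsto (stablePrimitive a b) Filter.atTop (nhds 0) := by
  have hlim : Filter.Tendsto (fun t : ℝ => (b + b ^ 2 * 5 + b ^ 3 * 23) * (720 / t))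
      Filter.atTop (nhds 0) := by
    simpa using (Filter.tendsto_id.const_div_atTop (720 : ℝ)).const_mul
      (b + b ^ 2 * 5 + b ^ 3 * 23)
  refine squeeze_zero_norm' ?_ hlim
  filter_upwards [Filter.eventually_ge_atTop 1] with t ht
  have k1 := mul_le_mul_of_nonneg_left (abs_stableKernel_le_of_one_le h1 ht) hb.le
  have k2 := mul_le_mul_of_nonneg_left (abs_stableKernelDeriv_le_of_one_le h1 h2 ht)
    (pow_pos hb 2).le
  have k3 := mul_le_mul_of_nonneg_left (abs_stableKernelDeriv₂_le_of_one_le h1 h2 ht)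
    (pow_pos hb 3).le
  rw [Real.norm_eq_abs]
  linarith [abs_stablePrimitive_le (a := a) hb t]

lemma abs_stablePrimitive_self_le (h1 : 3 / 2 ≤ a) (h2 : a < 2) (hb : 0 < b) (hb1 : b ≤ 1)
    (hl : 1 ≤ -Real.log b) :
    |stablePrimitive a b b| ≤ 29 * (b * b ^ a * -Real.log b) := by
  have k1 := mul_le_mul_of_nonneg_left (abs_stableKernel_le_of_le_one h1 hb hb1) hb.le
  have k2 := mul_le_mul_of_nonneg_left (abs_stableKernelDeriv_le_of_le_one h1 h2 hb hb1 hl)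
    (pow_pos hb 2).le
  have k3 := mul_le_mul_of_nonneg_left (abs_stableKernelDeriv₂_le_of_le_one h1 h2 hb hb1 hl)
    (pow_pos hb 3).le
  have e2 : b ^ 2 * (5 * (b ^ a * -Real.log b) / b) = 5 * (b * b ^ a * -Real.log b) := by
    field_simp
  have e3 : b ^ 3 * (23 * (b ^ a * -Real.log b) / b ^ 2) = 23 * (b * b ^ a * -Real.log b) := by
    field_simp
  rw [e2] at k2
  rw [e3] at k3
  linarith [abs_stablePrimitive_le (a := a) hb b]

lemma abs_integral_Ioi_cos_mul_stableKernel_le (h1 : 3 / 2 ≤ a) (h2 : a < 2) (hb : 0 < b)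
    (hb1 : b ≤ 1) (hl : 1 ≤ -Real.log b)
    (hfi : IntegrableOn (fun t => Real.cos (t * b⁻¹) * stableKernel a t) (Set.Ioi b)) :
    |∫ t in Set.Ioi b, Real.cos (t * b⁻¹) * stableKernel a t|
      ≤ 6377 * (b * b ^ a * -Real.log b) := by
  obtain ⟨hi, hle⟩ := integral_abs_stableKernelDeriv₃_le h1 h2 hb hb1 hl
  have hsin : ∀ t : ℝ, ‖Real.sin (t * b⁻¹) * stableKernelDeriv₃ a t‖ ≤ |stableKernelDeriv₃ a t| :=
    fun t => by
      rw [norm_mul, Real.norm_eq_abs, Real.norm_eq_abs]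
      exact mul_le_of_le_one_left (abs_nonneg _) (Real.abs_sin_le_one _)
  have hs : IntegrableOn (fun t => Real.sin (t * b⁻¹) * stableKernelDeriv₃ a t) (Set.Ioi b) :=
    hi.abs.mono' ((by fun_prop : Continuous fun t : ℝ => Real.sin (t * b⁻¹)).aestronglyMeasurable.mul
      hi.aestronglyMeasurable) (ae_of_all _ hsin)
  have hI := integral_Ioi_of_hasDerivAt_of_tendsto' (f := stablePrimitive a b)
    (fun t ht => hasDerivAt_stablePrimitive hb (hb.trans_le ht)) (hfi.sub (hs.const_mul (b ^ 3)))
    (tendsto_stablePrimitive h1 h2 hb)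
  rw [integral_sub hfi (hs.const_mul (b ^ 3)), integral_const_mul] at hI
  have hR : |∫ t in Set.Ioi b, Real.sin (t * b⁻¹) * stableKernelDeriv₃ a t|
      ≤ 6348 * (b ^ (a - 2) * -Real.log b) :=
    (norm_integral_le_of_norm_le hi.abs (ae_of_all _ hsin)).trans hle
  have hR' := abs_mul_le_mul (abs_of_pos (pow_pos hb 3)).le hR
  have e : b ^ 3 * (6348 * (b ^ (a - 2) * -Real.log b)) = 6348 * (b * b ^ a * -Real.log b) := by
    rw [Real.rpow_sub hb, show b ^ (2 : ℝ) = b ^ 2 by norm_cast]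
    field_simp
  rw [e] at hR'
  have hP := abs_stablePrimitive_self_le h1 h2 hb hb1 hl
  rw [abs_le] at *
  constructor <;> linarith

end Tail

lemma abs_stableKernel_le_of_le {a b t : ℝ} (h1 : 3 / 2 ≤ a) (ht : 0 < t) (htb : t ≤ b)
    (hl : 1 ≤ -Real.log b) : |stableKernel a t| ≤ 2 * (b ^ a * -Real.log b) := by
  have hb : 0 < b := ht.trans_le htb
  obtain ⟨s, rfl⟩ : ∃ s, t = b * s := ⟨t / b, by field_simp⟩
  have hs : 0 < s := pos_of_mul_pos_right ht hb.le
  have hs1 : s ≤ 1 := by nlinarith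
  have hsl := (Real.abs_log_mul_self_lt s hs hs1).le
  have hsa : s ^ a ≤ s := by
    simpa using Real.rpow_le_rpow_of_exponent_ge hs hs1 (by linarith : 1 ≤ a)
  rw [abs_mul, abs_of_pos hs] at hsl
  rw [stableKernel, abs_mul, Real.abs_exp]
  refine (mul_exp_neg_rpow_le_self ht.le (abs_nonneg _)).trans ?_
  rw [Real.mul_rpow hb.le hs.le, Real.log_mul hb.ne' hs.ne', abs_mul, abs_mul,
    abs_of_nonneg (by positivity : 0 ≤ b ^ a), abs_of_nonneg (by positivity : 0 ≤ s ^ a)]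
  calc b ^ a * s ^ a * |Real.log b + Real.log s|
      ≤ b ^ a * s * (-Real.log b + |Real.log s|) := by
        gcongr
        refine (abs_add_le _ _).trans_eq ?_
        rw [abs_of_nonpos (by linarith : Real.log b ≤ 0)]
    _ = b ^ a * (s * -Real.log b + |Real.log s| * s) := by ring
    _ ≤ b ^ a * (1 * -Real.log b + -Real.log b) := by
        gcongr
        exact hsl.trans hl
    _ = _ := by ring

lemma abs_integral_cos_mul_stableKernel_le {a b : ℝ} (h1 : 3 / 2 ≤ a) (h2 : a < 2) (hb : 0 < b)
    (hb1 : b ≤ 1) (hl : 1 ≤ -Real.log b) :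
    |∫ t in Set.Ioi (0 : ℝ), Real.cos (t * b⁻¹) * stableKernel a t|
      ≤ 6379 * (b * b ^ a * -Real.log b) := by
  by_cases hfi : IntegrableOn (fun t => Real.cos (t * b⁻¹) * stableKernel a t) (Set.Ioi 0)
  · have hu : Set.Ioi (0 : ℝ) = Set.Ioc 0 b ∪ Set.Ioi b := (Set.Ioc_union_Ioi_eq_Ioi hb.le).symm
    have hi₁ := hfi.mono_set (hu ▸ Set.subset_union_left)
    have hi₂ := hfi.mono_set (hu ▸ Set.subset_union_right)
    rw [hu, setIntegral_union Set.Ioc_disjoint_Ioi_same measurableSet_Ioi hi₁ hi₂]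
    have k1 : |∫ t in Set.Ioc 0 b, Real.cos (t * b⁻¹) * stableKernel a t|
        ≤ 2 * (b ^ a * -Real.log b) * b := by
      have h := norm_setIntegral_le_of_norm_le_const (μ := volume) (s := Set.Ioc 0 b)
        (f := fun t => Real.cos (t * b⁻¹) * stableKernel a t) (C := 2 * (b ^ a * -Real.log b))
        measure_Ioc_lt_top fun t ht => by
          rw [norm_mul, Real.norm_eq_abs, Real.norm_eq_abs]
          exact (mul_le_of_le_one_left (abs_nonneg _) (Real.abs_cos_le_one _)).trans
            (abs_stableKernel_le_of_le h1 ht.1 ht.2 hl)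
      simpa [hb.le] using h
    have k2 := abs_integral_Ioi_cos_mul_stableKernel_le h1 h2 hb hb1 hl hi₂
    refine (abs_add_le _ _).trans ?_
    linarith
  · rw [integral_undef hfi, abs_zero]
    positivity

/-- tail estimate for the θ-derivative of the symmetric stable density,
Lemma 3.1 of Matsui–Takemura: there are `θ₀ ∈ (0,1)`, `M > 0`, `x₀ > 0` such that for all
`θ ∈ (0, θ₀]` and `|x| ≥ x₀`,
`|(1/π) ∫₀^∞ cos(tx) t^{2-θ} log t exp(-t^{2-θ}) dt| ≤ M |x|^{θ-3} log|x|`. -/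
theorem stable_density_derivative_tail_bound :
    ∃ θ₀ ∈ Set.Ioo (0 : ℝ) 1, ∃ M : ℝ, 0 < M ∧ ∃ x₀ : ℝ, 0 < x₀ ∧
      ∀ θ ∈ Set.Ioc (0 : ℝ) θ₀, ∀ x : ℝ, x₀ ≤ |x| →
        |(1 / Real.pi) * ∫ t in Set.Ioi (0 : ℝ),
            Real.cos (t * x) * t ^ (2 - θ) * Real.log t * Real.exp (-(t ^ (2 - θ)))|
          ≤ M * |x| ^ (θ - 3) * Real.log |x| := by
  refine ⟨1 / 2, by norm_num, 6379, by norm_num, Real.exp 1, Real.exp_pos 1, ?_⟩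
  rintro θ ⟨hθ, hθ'⟩ x hx
  have hx0 : 0 < |x| := (Real.exp_pos 1).trans_le hx
  have hx1 : 1 ≤ |x| := (Real.one_le_exp zero_le_one).trans hx
  have hlog : 1 ≤ Real.log |x| := (Real.le_log_iff_exp_le hx0).2 hx
  have h := abs_integral_cos_mul_stableKernel_le (a := 2 - θ) (b := |x|⁻¹) (by linarith)
    (by linarith) (by positivity) (inv_le_one_of_one_le₀ hx1) (by rwa [Real.log_inv, neg_neg])
  have hcongr : ∀ t ∈ Set.Ioi (0 : ℝ),
      Real.cos (t * x) * t ^ (2 - θ) * Real.log t * Real.exp (-(t ^ (2 - θ)))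
        = Real.cos (t * |x|⁻¹⁻¹) * stableKernel (2 - θ) t := fun t ht => by
    have hcos : Real.cos (t * |x|) = Real.cos (t * x) := by
      rw [← Real.cos_abs (t * x), abs_mul, abs_of_pos (Set.mem_Ioi.1 ht)]
    rw [inv_inv, hcos, stableKernel]
    ring
  have hpow : |x|⁻¹ * |x|⁻¹ ^ (2 - θ) = |x| ^ (θ - 3) := by
    rw [Real.inv_rpow hx0.le, ← Real.rpow_neg hx0.le, ← Real.rpow_neg_one |x|,
      ← Real.rpow_add hx0]
    congr 1
    ring
  rw [Real.log_inv, neg_neg, hpow] at h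
  rw [setIntegral_congr_fun measurableSet_Ioi hcongr]
  have hpi : |1 / Real.pi| ≤ 1 := by
    rw [abs_of_pos (by positivity), div_le_one Real.pi_pos]
    linarith [Real.pi_gt_three]
  linarith [abs_mul_le_mul hpi h]
end

section
/- Fix p ≥ 1, n ≥ p + 2, θ₁ > 0 and k > 0. Let f(·;0) and f(·;θ₁) be probability densities on ℝ^p. For X ∈ ℝ^{n×p} with rows x₁,…,xₙ define N_θ(X) = ∫_{GL(p)} ∫_{ℝ^p} ∏_{i=1}^n f(a + B·xᵢ ; θ) · |det B|^{n−p−1} da dB, where the outer integral is over all real p×p matrices B with det B ≠ 0 with respect to Lebesgue measure dB, and assume N₀(X) and N_{θ₁}(X) are finite with N₀(X) > 0 for a.e. X. Let R* = { X : N_{θ₁}(X) > k · N₀(X) }. Then for every measurable R ⊆ ℝ^{n×p} that is invariant under X ↦ 1ₙ a′ + X B′ for all a ∈ ℝ^p and invertible B ∈ ℝ^{p×p}, the inequality ∫_R ∏_{i=1}^n f(xᵢ;0) dX ≤ ∫_{R*} ∏_{i=1}^n f(xᵢ;0) dX implies ∫_R ∏_{i=1}^n f(xᵢ;θ₁) dX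 ≤ ∫_{R*} ∏_{i=1}^n f(xᵢ;θ₁) dX. -/
open MeasureTheory
open scoped ENNReal

/-- The integrated likelihood under the full affine group:
`N_f(X) = ∫_{GL(p)} ∫_{ℝ^p} ∏ᵢ f(a + B xᵢ) |det B|^{n-p-1} da dB`
(as a Lebesgue integral, so that finiteness is meaningful). -/
noncomputable def intLikGL (n p : ℕ) (f : (Fin p → ℝ) → ℝ) (X : Fin n → Fin p → ℝ) : ℝ≥0∞ :=
  ∫⁻ B in {B : Fin p → Fin p → ℝ | (Matrix.of B).det ≠ 0}, ∫⁻ a : Fin p → ℝ,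
    (∏ i, ENNReal.ofReal (f (a + (Matrix.of B).mulVec (X i)))) *
      ENNReal.ofReal (|(Matrix.of B).det| ^ (n - p - 1))

open scoped Matrix

lemma lintegral_comp_linearMap {E : Type*} [NormedAddCommGroup E] [NormedSpace ℝ E]
    [MeasurableSpace E] [BorelSpace E] [FiniteDimensional ℝ E] (μ : Measure E) [μ.IsAddHaarMeasure]
    {f : E →ₗ[ℝ] E} (hf : LinearMap.det f ≠ 0) {G : E → ℝ≥0∞} (hG : Measurable G) :
    ENNReal.ofReal |LinearMap.det f| * ∫⁻ x, G (f x) ∂μ = ∫⁻ x, G x ∂μ := by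
  have hmeas : Measurable f := (LinearMap.continuous_of_finiteDimensional f).measurable
  rw [← lintegral_map hG hmeas, Measure.map_linearMap_addHaar_eq_smul_addHaar μ hf,
    lintegral_smul_measure, smul_eq_mul, ← mul_assoc, ← ENNReal.ofReal_mul (abs_nonneg _),
    ← abs_mul, mul_inv_cancel₀ hf]
  simp

lemma lintegral_mulVec {κ : Type*} [Fintype κ] [DecidableEq κ] {B : Matrix κ κ ℝ}
    (hB : B.det ≠ 0) {G : (κ → ℝ) → ℝ≥0∞} (hG : Measurable G) :
    ENNReal.ofReal |B.det| * ∫⁻ x, G (B *ᵥ x) = ∫⁻ x, G x := by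
  simpa using lintegral_comp_linearMap volume (f := Matrix.toLin' B) (by simpa using hB) hG

lemma lintegral_pi_mulVec {ι κ : Type*} [Fintype ι] [Fintype κ] [DecidableEq κ]
    {B : Matrix κ κ ℝ} (hB : B.det ≠ 0) {G : (ι → κ → ℝ) → ℝ≥0∞} (hG : Measurable G) :
    ENNReal.ofReal |B.det| ^ Fintype.card ι * ∫⁻ X : ι → κ → ℝ, G (fun i => B *ᵥ X i) =
      ∫⁻ X, G X := by
  let f : (ι → κ → ℝ) →ₗ[ℝ] (ι → κ → ℝ) :=
    LinearMap.pi fun i => (Matrix.toLin' B).comp (LinearMap.proj i)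
  have hf : LinearMap.det f = B.det ^ Fintype.card ι := by
    simp [f, LinearMap.det_pi]
  have h := lintegral_comp_linearMap volume (f := f) (hf ▸ pow_ne_zero _ hB) hG
  rw [hf, abs_pow, ENNReal.ofReal_pow (abs_nonneg _)] at h
  exact h

lemma abs_det_mul_mul {κ : Type*} [Fintype κ] [DecidableEq κ] (P Q : Matrix κ κ ℝ)
    (f : (κ → κ → ℝ) →ₗ[ℝ] (κ → κ → ℝ))
    (hf : ∀ C, f C = Matrix.of.symm (P * Matrix.of C * Q)) :
    |LinearMap.det f| = |P.det| ^ Fintype.card κ * |Q.det| ^ Fintype.card κ := by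
  let r (A : Matrix κ κ ℝ) : (κ → κ → ℝ) →ₗ[ℝ] (κ → κ → ℝ) :=
    LinearMap.pi fun i => (Matrix.toLin' A).comp (LinearMap.proj i)
  have hr (A : Matrix κ κ ℝ) : LinearMap.det (r A) = A.det ^ Fintype.card κ := by
    simp [r, LinearMap.det_pi]
  let T : (κ → κ → ℝ) →ₗ[ℝ] (κ → κ → ℝ) :=
    { toFun := fun C i j => C j i, map_add' := fun _ _ => rfl, map_smul' := fun _ _ => rfl }
  have hT : LinearMap.det T * LinearMap.det T = 1 := by
    rw [← LinearMap.det_comp]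
    exact LinearMap.det_id
  have hcomp : f = (r Qᵀ).comp (T.comp ((r P).comp T)) := by
    refine LinearMap.ext fun C => funext fun i => funext fun j => ?_
    simp [hf, r, T, Matrix.mul_apply, Matrix.mulVec, dotProduct, mul_comm]
  rw [hcomp, LinearMap.det_comp, LinearMap.det_comp, LinearMap.det_comp, hr, hr,
    Matrix.det_transpose, mul_left_comm (LinearMap.det T), hT, mul_one, abs_mul, abs_pow, abs_pow,
    mul_comm]

attribute [local instance] Matrix.linftyOpNormedRing Matrix.linftyOpNormedAlgebra in
lemma exists_hasFDerivAt_matrix_inv {κ : Type*} [Fintype κ] [DecidableEq κ]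
    {B : κ → κ → ℝ} (hB : (Matrix.of B).det ≠ 0) :
    ∃ f' : (κ → κ → ℝ) →L[ℝ] (κ → κ → ℝ),
      HasFDerivAt (fun C : κ → κ → ℝ => Matrix.of.symm (Matrix.of C)⁻¹) f' B ∧
      ∀ C, f' C = Matrix.of.symm (-((Matrix.of B)⁻¹ * Matrix.of C * (Matrix.of B)⁻¹)) := by
  let e : (κ → κ → ℝ) ≃L[ℝ] Matrix κ κ ℝ :=
    (Matrix.ofLinearEquiv ℝ : (κ → κ → ℝ) ≃ₗ[ℝ] Matrix κ κ ℝ).toContinuousLinearEquiv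
  let u := (Matrix.isUnit_iff_isUnit_det (Matrix.of B)).2 hB.isUnit |>.unit
  have hu : HasFDerivAt Ring.inverse
      (-ContinuousLinearMap.mulLeftRight ℝ (Matrix κ κ ℝ) ↑u⁻¹ ↑u⁻¹) (e B) :=
    hasFDerivAt_ringInverse u
  refine ⟨_, (e.symm.hasFDerivAt.comp B (hu.comp B e.hasFDerivAt)).congr_of_eventuallyEq ?_, ?_⟩
  · filter_upwards with C
    simp [Matrix.nonsing_inv_eq_ringInverse]
    rfl
  · intro C
    have : (↑u⁻¹ : Matrix κ κ ℝ) = (Matrix.of B)⁻¹ := by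
      simp [u, Matrix.coe_units_inv]
    simp [this]
    rfl

lemma measurableSet_det_ne_zero {κ : Type*} [Fintype κ] [DecidableEq κ] :
    MeasurableSet {B : κ → κ → ℝ | (Matrix.of B).det ≠ 0} := by
  have h : Continuous fun B : κ → κ → ℝ => (Matrix.of B).det :=
    Continuous.matrix_det (A := fun B : κ → κ → ℝ => Matrix.of B) continuous_id
  exact (isOpen_ne.preimage h).measurableSet

lemma setLIntegral_matrix_inv {κ : Type*} [Fintype κ] [DecidableEq κ]
    (G : Matrix κ κ ℝ → ℝ≥0∞) :
    ∫⁻ B in {B : κ → κ → ℝ | (Matrix.of B).det ≠ 0}, G (Matrix.of B) =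
      ∫⁻ B in {B : κ → κ → ℝ | (Matrix.of B).det ≠ 0},
        (ENNReal.ofReal |(Matrix.of B).det|)⁻¹ ^ (2 * Fintype.card κ) * G (Matrix.of B)⁻¹ := by
  set U := {B : κ → κ → ℝ | (Matrix.of B).det ≠ 0} with hU
  let inv : (κ → κ → ℝ) → (κ → κ → ℝ) := fun C => Matrix.of.symm (Matrix.of C)⁻¹
  have hinv : ∀ B ∈ U, inv (inv B) = B := fun B hB => by
    simp [inv, Matrix.nonsing_inv_nonsing_inv _ (IsUnit.mk0 _ hB)]
  have hmem : ∀ B ∈ U, inv B ∈ U := fun B hB => by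
    simpa [inv, hU, Matrix.det_nonsing_inv] using hB
  have himg : inv '' U = U := by
    refine Set.Subset.antisymm (Set.image_subset_iff.2 hmem) fun B hB => ?_
    exact ⟨inv B, hmem B hB, hinv B hB⟩
  have hinj : Set.InjOn inv U := fun B hB C hC h => by
    rw [← hinv B hB, h, hinv C hC]
  choose! f' hf' hf'C using fun (B : κ → κ → ℝ) (hB : B ∈ U) => exists_hasFDerivAt_matrix_inv hB
  have key := lintegral_image_eq_lintegral_abs_det_fderiv_mul volume
    measurableSet_det_ne_zero (fun B hB => (hf' B hB).hasFDerivWithinAt) hinj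
    (fun B => G (Matrix.of B))
  rw [himg] at key
  rw [key]
  refine setLIntegral_congr_fun measurableSet_det_ne_zero fun B hB => ?_
  have hd : 0 < |(Matrix.of B).det| := abs_pos.2 hB
  have hdet : |(f' B).det| = (|(Matrix.of B).det|⁻¹) ^ (2 * Fintype.card κ) := by
    rw [ContinuousLinearMap.det, abs_det_mul_mul (-(Matrix.of B)⁻¹) (Matrix.of B)⁻¹ _
      fun C => by simpa using hf'C B hB C]
    simp [Matrix.det_neg, abs_mul, Matrix.det_nonsing_inv, two_mul, pow_add, abs_inv]
  simp only [Equiv.apply_symm_apply]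
  rw [hdet, ENNReal.ofReal_pow (by positivity), ENNReal.ofReal_inv_of_pos hd]

/-- The action of the affine map `x ↦ a + B x` on each row of a data matrix. -/
def affineAct {ι κ : Type*} [Fintype κ] (a : κ → ℝ) (B : Matrix κ κ ℝ) (X : ι → κ → ℝ) :
    ι → κ → ℝ :=
  fun i => a + B *ᵥ X i

/-- The integral of `F` along the affine orbit of `X`, weighted by `|det B| ^ m`. -/
noncomputable def orbitIntegral {ι κ : Type*} [Fintype κ] [DecidableEq κ] (m : ℕ)
    (F : (ι → κ → ℝ) → ℝ≥0∞) (X : ι → κ → ℝ) : ℝ≥0∞ :=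
  ∫⁻ B in {B : κ → κ → ℝ | (Matrix.of B).det ≠ 0}, ∫⁻ a : κ → ℝ,
    F (affineAct a (Matrix.of B) X) * ENNReal.ofReal |(Matrix.of B).det| ^ m

lemma affineAct_affineAct {ι κ : Type*} [Fintype κ] (a b : κ → ℝ) (A B : Matrix κ κ ℝ)
    (X : ι → κ → ℝ) :
    affineAct a B (affineAct b A X) = affineAct (a + B *ᵥ b) (B * A) X := by
  funext i
  simp [affineAct, Matrix.mulVec_add, add_assoc]

lemma measurable_affineAct {ι κ α : Type*} [Fintype κ] [MeasurableSpace α]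
    {a : α → κ → ℝ} {B : α → κ → κ → ℝ}
    {X : α → ι → κ → ℝ} (ha : Measurable a) (hB : Measurable B) (hX : Measurable X) :
    Measurable fun t => affineAct (a t) (Matrix.of (B t)) (X t) := by
  refine measurable_pi_lambda _ fun i => measurable_pi_lambda _ fun j => ?_
  simp only [affineAct, Pi.add_apply, Matrix.mulVec, dotProduct, Matrix.of_apply]
  fun_prop

lemma measurable_ofReal_abs_det {κ : Type*} [Fintype κ] [DecidableEq κ] :
    Measurable fun B : κ → κ → ℝ => ENNReal.ofReal |(Matrix.of B).det| := by
  have h : Continuous fun B : κ → κ → ℝ => (Matrix.of B).det :=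
    Continuous.matrix_det (A := fun B : κ → κ → ℝ => Matrix.of B) continuous_id
  exact (continuous_abs.comp h).measurable.ennreal_ofReal

section

variable {ι κ : Type*} [Fintype κ] [DecidableEq κ]

lemma measurable_orbitIntegral (m : ℕ) {F : (ι → κ → ℝ) → ℝ≥0∞} (hF : Measurable F) :
    Measurable (orbitIntegral m F) := by
  refine Measurable.lintegral_prod_right (f := fun (X : ι → κ → ℝ) (B : κ → κ → ℝ) => ∫⁻ a : κ → ℝ,
    F (affineAct a (Matrix.of B) X) * ENNReal.ofReal |(Matrix.of B).det| ^ m) ?_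
  refine Measurable.lintegral_prod_right
    (f := fun (t : (ι → κ → ℝ) × (κ → κ → ℝ)) (a : κ → ℝ) =>
      F (affineAct a (Matrix.of t.2) t.1) * ENNReal.ofReal |(Matrix.of t.2).det| ^ m) ?_
  refine (hF.comp (measurable_affineAct ?_ ?_ ?_)).mul
    ((measurable_ofReal_abs_det.comp ?_).pow_const m) <;> fun_prop

lemma orbitIntegral_affineAct (m : ℕ) {F : (ι → κ → ℝ) → ℝ≥0∞} (hF : Measurable F)
    (a : κ → ℝ) {A : Matrix κ κ ℝ} (hA : A.det ≠ 0) (X : ι → κ → ℝ) :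
    ENNReal.ofReal |A.det| ^ (m + Fintype.card κ) * orbitIntegral m F (affineAct a A X) =
      orbitIntegral m F X := by
  let H : Matrix κ κ ℝ → ℝ≥0∞ := fun B =>
    ∫⁻ b : κ → ℝ, F (affineAct b B X) * ENNReal.ofReal |B.det| ^ m
  have hH : Measurable fun B : κ → κ → ℝ => H (Matrix.of B) := by
    refine Measurable.lintegral_prod_right
      (f := fun (B : κ → κ → ℝ) (a : κ → ℝ) =>
        F (affineAct a (Matrix.of B) X) * ENNReal.ofReal |(Matrix.of B).det| ^ m) ?_
    refine (hF.comp (measurable_affineAct ?_ ?_ ?_)).mul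
      ((measurable_ofReal_abs_det.comp ?_).pow_const m) <;> fun_prop
  have hU := measurableSet_det_ne_zero (κ := κ)
  have hmul := lintegral_pi_mulVec (ι := κ) (B := Aᵀ) (by simpa using hA) (hH.indicator hU)
  rw [lintegral_indicator hU, Matrix.det_transpose] at hmul
  refine Eq.trans ?_ hmul
  rw [pow_add, mul_comm (_ ^ m), mul_assoc]
  congr 1
  rw [orbitIntegral, ← lintegral_indicator hU,
    ← lintegral_const_mul' _ _ (ENNReal.pow_ne_top ENNReal.ofReal_ne_top)]
  refine lintegral_congr fun B => ?_
  have hrow : Matrix.of (fun i => Aᵀ *ᵥ B i) = Matrix.of B * A := by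
    ext i j
    simp [Matrix.mul_apply, Matrix.mulVec, dotProduct, mul_comm]
  simp only [Set.indicator_apply, Set.mem_ofPred_eq, hrow, Matrix.det_mul, mul_ne_zero_iff, hA,
    ne_eq, not_false_eq_true, and_true, mul_ite, mul_zero]
  split_ifs with hB
  · rfl
  simp only [H, affineAct_affineAct]
  rw [lintegral_add_right_eq_self (μ := volume) (fun b =>
    F (affineAct b (Matrix.of B * A) X) * ENNReal.ofReal |(Matrix.of B).det| ^ m),
    ← lintegral_const_mul' _ _ (ENNReal.pow_ne_top ENNReal.ofReal_ne_top)]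
  refine lintegral_congr fun b => ?_
  rw [Matrix.det_mul, abs_mul, ENNReal.ofReal_mul (abs_nonneg _), mul_pow]
  ring

lemma lintegral_affineAct [Fintype ι] (a : κ → ℝ) {B : Matrix κ κ ℝ} (hB : B.det ≠ 0)
    {G : (ι → κ → ℝ) → ℝ≥0∞} (hG : Measurable G) :
    ENNReal.ofReal |B.det| ^ Fintype.card ι * ∫⁻ X, G (affineAct a B X) = ∫⁻ X, G X := by
  have h := lintegral_pi_mulVec hB (G := fun X : ι → κ → ℝ => G ((fun _ => a) + X))
    (by fun_prop)
  rw [lintegral_add_left_eq_self] at h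
  exact h

/-- Exchanging the roles of two densities inside an integral against a relatively invariant
weight `K`. -/
lemma lintegral_mul_orbitIntegral_comm [Fintype ι] (m : ℕ)
    (hm : m + Fintype.card κ + 1 = Fintype.card ι)
    {F₀ F₁ K : (ι → κ → ℝ) → ℝ≥0∞} (hF₀ : Measurable F₀) (hF₁ : Measurable F₁) (hK : Measurable K)
    (hKact : ∀ (a : κ → ℝ) (B : Matrix κ κ ℝ), B.det ≠ 0 → ∀ X,
      K (affineAct a B X) = ENNReal.ofReal |B.det| ^ (m + Fintype.card κ) * K X) :
    ∫⁻ X, K X * F₁ X * orbitIntegral m F₀ X = ∫⁻ X, K X * F₀ X * orbitIntegral m F₁ X := by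
  let d : Matrix κ κ ℝ → ℝ≥0∞ := fun B => ENNReal.ofReal |B.det|
  have hdm : Measurable fun B : κ → κ → ℝ => d (Matrix.of B) := measurable_ofReal_abs_det
  have hdtop : ∀ B, d B ≠ ⊤ := fun B => ENNReal.ofReal_ne_top
  have hd0 : ∀ B, B.det ≠ 0 → d B ≠ 0 := fun B hB => by simpa [d] using hB
  have hU := measurableSet_det_ne_zero (κ := κ)
  -- Tonelli for the weighted orbit integrals
  have tonelli : ∀ F G : (ι → κ → ℝ) → ℝ≥0∞, Measurable F → Measurable G →
      ∫⁻ X, K X * G X * orbitIntegral m F X =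
        ∫⁻ B in {B : κ → κ → ℝ | (Matrix.of B).det ≠ 0}, ∫⁻ a : κ → ℝ, ∫⁻ X,
          K X * G X * (F (affineAct a (Matrix.of B) X) * d (Matrix.of B) ^ m) := by
    intro F G hF hG
    have hmeas : Measurable fun t : ((ι → κ → ℝ) × (κ → κ → ℝ)) × (κ → ℝ) =>
        K t.1.1 * G t.1.1 *
          (F (affineAct t.2 (Matrix.of t.1.2) t.1.1) * d (Matrix.of t.1.2) ^ m) := by
      refine ((hK.comp (by fun_prop)).mul (hG.comp (by fun_prop))).mul
        ((hF.comp (measurable_affineAct ?_ ?_ ?_)).mul ((hdm.comp ?_).pow_const m)) <;> fun_prop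
    calc ∫⁻ X, K X * G X * orbitIntegral m F X
        = ∫⁻ X, ∫⁻ B in {B : κ → κ → ℝ | (Matrix.of B).det ≠ 0}, ∫⁻ a : κ → ℝ,
            K X * G X * (F (affineAct a (Matrix.of B) X) * d (Matrix.of B) ^ m) := by
          refine lintegral_congr fun X => ?_
          have h1 : ∀ B : κ → κ → ℝ, Measurable fun a : κ → ℝ =>
              F (affineAct a (Matrix.of B) X) * d (Matrix.of B) ^ m := fun B =>
            (hF.comp (measurable_affineAct measurable_id measurable_const
              measurable_const)).mul_const _
          have h2 : Measurable fun B : κ → κ → ℝ => ∫⁻ a : κ → ℝ,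
              F (affineAct a (Matrix.of B) X) * d (Matrix.of B) ^ m := by
            refine Measurable.lintegral_prod_right (f := fun (B : κ → κ → ℝ) (a : κ → ℝ) =>
              F (affineAct a (Matrix.of B) X) * d (Matrix.of B) ^ m) ?_
            refine (hF.comp (measurable_affineAct ?_ ?_ ?_)).mul
              ((hdm.comp ?_).pow_const m) <;> fun_prop
          rw [orbitIntegral, ← lintegral_const_mul _ h2]
          exact lintegral_congr fun B => (lintegral_const_mul _ (h1 B)).symm
      _ = ∫⁻ B in {B : κ → κ → ℝ | (Matrix.of B).det ≠ 0}, ∫⁻ X, ∫⁻ a : κ → ℝ,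
            K X * G X * (F (affineAct a (Matrix.of B) X) * d (Matrix.of B) ^ m) :=
          lintegral_lintegral_swap hmeas.lintegral_prod_right'.aemeasurable
      _ = _ := by
          refine lintegral_congr fun B => lintegral_lintegral_swap ?_
          have hslice : Measurable fun t : (ι → κ → ℝ) × (κ → ℝ) => ((t.1, B), t.2) := by fun_prop
          exact (hmeas.comp hslice).aemeasurable
  rw [tonelli F₀ F₁ hF₀ hF₁, tonelli F₁ F₀ hF₁ hF₀]
  rw [setLIntegral_matrix_inv (fun B => ∫⁻ a : κ → ℝ, ∫⁻ X,
    K X * F₀ X * (F₁ (affineAct a B X) * d B ^ m))]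
  refine setLIntegral_congr_fun hU fun B' hB => ?_
  set B : Matrix κ κ ℝ := Matrix.of B' with hB'
  change B.det ≠ 0 at hB
  have hBinv : B⁻¹.det ≠ 0 := by simpa [Matrix.det_nonsing_inv] using hB
  have hdinv : d B⁻¹ = (d B)⁻¹ := by
    simp only [d, Matrix.det_nonsing_inv, Ring.inverse_eq_inv', abs_inv]
    exact ENNReal.ofReal_inv_of_pos (abs_pos.2 hB)
  have hcancel : ∀ j : ℕ, (d B)⁻¹ ^ j * d B ^ j = 1 := fun j => by
    rw [← mul_pow, ENNReal.inv_mul_cancel (hd0 B hB) (hdtop B), one_pow]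
  have hmul : B⁻¹ * B = 1 := Matrix.nonsing_inv_mul _ (IsUnit.mk0 _ hB)
  have hmeas : Measurable fun t : (κ → ℝ) × (ι → κ → ℝ) =>
      K t.2 * F₀ t.2 * F₁ (affineAct t.1 B⁻¹ t.2) := by
    refine ((hK.mul hF₀).comp measurable_snd).mul (hF₁.comp ?_)
    exact measurable_affineAct (B := fun _ => Matrix.of.symm B⁻¹) measurable_fst measurable_const
      measurable_snd
  -- change of variables in the data
  have hdata : ∀ a : κ → ℝ, ∫⁻ X, K X * F₁ X * (F₀ (affineAct a B X) * d B ^ m) =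
      (d B)⁻¹ ^ (m + Fintype.card κ + Fintype.card ι) * d B ^ m *
        ∫⁻ X, K X * F₀ X * F₁ (affineAct (B⁻¹ *ᵥ (-a)) B⁻¹ X) := by
    intro a
    rw [← lintegral_affineAct a hB (G := fun X => K X * F₀ X * F₁ (affineAct (B⁻¹ *ᵥ (-a)) B⁻¹ X))
      (hmeas.comp measurable_prodMk_left), ← mul_assoc,
      ← lintegral_const_mul' _ _ (by
        have := hd0 B hB
        finiteness)]
    refine lintegral_congr fun X => ?_
    have hX : affineAct (B⁻¹ *ᵥ (-a)) B⁻¹ (affineAct a B X) = X := by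
      rw [affineAct_affineAct, hmul, ← Matrix.mulVec_add]
      funext i
      simp [affineAct]
    simp only [hX, hKact a B hB]
    calc K X * F₁ X * (F₀ (affineAct a B X) * d B ^ m)
        = ((d B)⁻¹ ^ (m + Fintype.card κ + Fintype.card ι) *
            d B ^ (m + Fintype.card κ + Fintype.card ι)) *
            (K X * F₁ X * (F₀ (affineAct a B X) * d B ^ m)) := by rw [hcancel, one_mul]
      _ = _ := by
          simp only [d, pow_add]
          ring
  -- change of variables in the translation
  have htrans : ∫⁻ a : κ → ℝ, ∫⁻ X, K X * F₀ X * F₁ (affineAct (B⁻¹ *ᵥ (-a)) B⁻¹ X) =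
      d B * ∫⁻ a : κ → ℝ, ∫⁻ X, K X * F₀ X * F₁ (affineAct a B⁻¹ X) := by
    have h := lintegral_mulVec hBinv (hmeas.lintegral_prod_right' (ν := volume))
    change d B⁻¹ * _ = _ at h
    rw [← h, hdinv, ← mul_assoc, ENNReal.mul_inv_cancel (hd0 B hB) (hdtop B), one_mul]
    exact lintegral_neg_eq_self (μ := volume) fun a : κ → ℝ =>
      ∫⁻ X, K X * F₀ X * F₁ (affineAct (B⁻¹ *ᵥ a) B⁻¹ X)
  have hpow : (d B)⁻¹ ^ (m + Fintype.card κ + Fintype.card ι) * d B ^ m * d B =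
      (d B)⁻¹ ^ (2 * Fintype.card κ) * (d B)⁻¹ ^ m := by
    rw [mul_assoc, ← pow_succ, ← hm,
      show m + Fintype.card κ + (m + Fintype.card κ + 1) =
        2 * Fintype.card κ + m + (m + 1) by ring, pow_add _ _ (m + 1), mul_assoc, hcancel,
      mul_one, pow_add]
  have hfin : (d B)⁻¹ ≠ ⊤ := ENNReal.inv_ne_top.2 (hd0 B hB)
  simp only [hdata, hdinv]
  rw [lintegral_const_mul' _ _ (by finiteness), htrans, ← mul_assoc, hpow, mul_assoc,
    ← lintegral_const_mul' _ _ (by finiteness)]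
  congr 1
  refine lintegral_congr fun a => ?_
  rw [← lintegral_const_mul' _ _ (by finiteness)]
  refine lintegral_congr fun X => ?_
  ring

lemma setLIntegral_eq_ratio_orbitIntegral [Fintype ι] (m : ℕ)
    (hm : m + Fintype.card κ + 1 = Fintype.card ι)
    {F₀ F₁ : (ι → κ → ℝ) → ℝ≥0∞} (hF₀ : Measurable F₀) (hF₁ : Measurable F₁)
    (hN : ∀ᵐ X, orbitIntegral m F₀ X < ⊤ ∧ 0 < orbitIntegral m F₀ X)
    {S : Set (ι → κ → ℝ)} (hS : MeasurableSet S)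
    (hSact : ∀ (a : κ → ℝ) (B : Matrix κ κ ℝ), B.det ≠ 0 → ∀ X, X ∈ S ↔ affineAct a B X ∈ S) :
    ∫⁻ X in S, F₁ X =
      ∫⁻ X in S, (orbitIntegral m F₀ X)⁻¹ * orbitIntegral m F₁ X * F₀ X := by
  have hmeas := measurable_orbitIntegral m hF₀
  have key := lintegral_mul_orbitIntegral_comm m hm hF₀ hF₁ (hmeas.inv.indicator hS) ?_
  · rw [← lintegral_indicator hS, ← lintegral_indicator hS]
    refine (lintegral_congr_ae ?_).trans (key.trans (lintegral_congr fun X => ?_))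
    · filter_upwards [hN] with X hX
      by_cases hXS : X ∈ S
      · simp only [Set.indicator_of_mem hXS, Pi.inv_apply]
        rw [mul_right_comm, ENNReal.inv_mul_cancel hX.2.ne' hX.1.ne, one_mul]
      · simp [hXS]
    · by_cases hXS : X ∈ S
      · simp only [Set.indicator_of_mem hXS, Pi.inv_apply]
        ring
      · simp [hXS]
  · intro a B hB X
    by_cases hXS : X ∈ S
    · have hd : ENNReal.ofReal |B.det| ^ (m + Fintype.card κ) ≠ 0 := by simp [hB]
      have hd' : ENNReal.ofReal |B.det| ^ (m + Fintype.card κ) ≠ ⊤ := by finiteness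
      simp only [Set.indicator_of_mem hXS, Set.indicator_of_mem ((hSact a B hB X).1 hXS),
        Pi.inv_apply]
      rw [← orbitIntegral_affineAct m hF₀ a hB X, ENNReal.mul_inv (.inl hd) (.inl hd'),
        ← mul_assoc, ENNReal.mul_inv_cancel hd hd', one_mul]
    · simp [hXS, (hSact a B hB X).not.1 hXS]

end

lemma setLIntegral_le_of_neymanPearson {α : Type*} [MeasurableSpace α] {μ : Measure α}
    {F₀ F₁ : α → ℝ≥0∞} {c : ℝ≥0∞} {R T : Set α} (hR : MeasurableSet R) (hT : MeasurableSet T)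
    (hfin : ∫⁻ x, F₀ x ∂μ ≠ ⊤)
    (hTR : c * ∫⁻ x in T \ R, F₀ x ∂μ ≤ ∫⁻ x in T \ R, F₁ x ∂μ)
    (hRT : ∫⁻ x in R \ T, F₁ x ∂μ ≤ c * ∫⁻ x in R \ T, F₀ x ∂μ)
    (h : ∫⁻ x in R, F₀ x ∂μ ≤ ∫⁻ x in T, F₀ x ∂μ) :
    ∫⁻ x in R, F₁ x ∂μ ≤ ∫⁻ x in T, F₁ x ∂μ := by
  rw [← lintegral_inter_add_sdiff F₀ R hT, ← lintegral_inter_add_sdiff F₀ T hR,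
    Set.inter_comm T R] at h
  have hfin' : ∫⁻ x in R ∩ T, F₀ x ∂μ ≠ ⊤ :=
    ne_top_of_le_ne_top hfin (setLIntegral_le_lintegral _ _)
  rw [← lintegral_inter_add_sdiff F₁ R hT, ← lintegral_inter_add_sdiff F₁ T hR,
    Set.inter_comm T R]
  refine add_le_add_right ?_ _
  calc ∫⁻ x in R \ T, F₁ x ∂μ ≤ c * ∫⁻ x in R \ T, F₀ x ∂μ := hRT
    _ ≤ c * ∫⁻ x in T \ R, F₀ x ∂μ := by
        gcongr 1
        exact (ENNReal.add_le_add_iff_left hfin').1 h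
    _ ≤ _ := hTR

lemma lintegral_prod_ofReal_ne_top {n : ℕ} {α : Type*} [MeasureSpace α]
    [SigmaFinite (volume : Measure α)] {f : α → ℝ} (hf : Measurable f)
    (hf0 : ∀ x, 0 ≤ f x) (hfin : ∫⁻ x, ENNReal.ofReal (f x) ≠ ⊤) :
    ∫⁻ X : Fin n → α, ∏ i, ENNReal.ofReal (f (X i)) ≠ ⊤ := by
  have hf_int : Integrable f :=
    (lintegral_ofReal_ne_top_iff_integrable hf.aestronglyMeasurable (ae_of_all _ hf0)).1 hfin
  have hprod : Integrable fun X : Fin n → α => ∏ i, f (X i) :=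
    Integrable.fintype_prod fun _ => hf_int
  convert hprod.lintegral_lt_top.ne using 3 with X
  exact (ENNReal.ofReal_prod_of_nonneg fun i _ => hf0 _).symm

lemma intLikGL_eq_orbitIntegral (n p : ℕ) (f : (Fin p → ℝ) → ℝ) :
    intLikGL n p f = orbitIntegral (n - p - 1) fun X => ∏ i, ENNReal.ofReal (f (X i)) := by
  funext X
  simp only [intLikGL, orbitIntegral, ENNReal.ofReal_pow (abs_nonneg _), affineAct]

/-- Proposition 2 of the paper: the region
`R* = {X : N_{θ₁}(X) > k N₀(X)}` given by the ratio of the integrated likelihoods is the most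
powerful test of `f₀` against `f₁` among regions invariant under the full affine group
`ℝ^p × GL(p)` acting by `X ↦ 1ₙ a' + X B'` (rows `xᵢ ↦ a + B xᵢ`). -/
theorem most_powerful_affine_invariant_test (p n : ℕ) (hp : 1 ≤ p) (hn : p + 2 ≤ n)
    (θ₁ k : ℝ) (hθ₁ : 0 < θ₁) (hk : 0 < k)
    (f0 f1 : (Fin p → ℝ) → ℝ)
    (hf0m : Measurable f0) (hf1m : Measurable f1)
    (hf0nn : ∀ x, 0 ≤ f0 x) (hf1nn : ∀ x, 0 ≤ f1 x)
    (hf0d : (∫⁻ x : Fin p → ℝ, ENNReal.ofReal (f0 x)) = 1)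
    (hf1d : (∫⁻ x : Fin p → ℝ, ENNReal.ofReal (f1 x)) = 1)
    (hfin : ∀ᵐ X : Fin n → Fin p → ℝ,
      intLikGL n p f0 X < ⊤ ∧ intLikGL n p f1 X < ⊤ ∧ 0 < intLikGL n p f0 X) :
    ∀ R : Set (Fin n → Fin p → ℝ), MeasurableSet R →
      (∀ (a : Fin p → ℝ) (B : Matrix (Fin p) (Fin p) ℝ), B.det ≠ 0 →
        ∀ X : Fin n → Fin p → ℝ, X ∈ R ↔ (fun i => a + B.mulVec (X i)) ∈ R) →
      (∫⁻ X in R, ∏ i, ENNReal.ofReal (f0 (X i))) ≤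
        (∫⁻ X in {X : Fin n → Fin p → ℝ |
            ENNReal.ofReal k * intLikGL n p f0 X < intLikGL n p f1 X},
          ∏ i, ENNReal.ofReal (f0 (X i))) →
      (∫⁻ X in R, ∏ i, ENNReal.ofReal (f1 (X i))) ≤
        (∫⁻ X in {X : Fin n → Fin p → ℝ |
            ENNReal.ofReal k * intLikGL n p f0 X < intLikGL n p f1 X},
          ∏ i, ENNReal.ofReal (f1 (X i))) := by
  intro R hR hRact hle
  set F₀ : (Fin n → Fin p → ℝ) → ℝ≥0∞ := fun X => ∏ i, ENNReal.ofReal (f0 (X i))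
  set F₁ : (Fin n → Fin p → ℝ) → ℝ≥0∞ := fun X => ∏ i, ENNReal.ofReal (f1 (X i))
  have hF₀ : Measurable F₀ := Finset.measurable_fun_prod _ fun i _ => by fun_prop
  have hF₁ : Measurable F₁ := Finset.measurable_fun_prod _ fun i _ => by fun_prop
  set c := ENNReal.ofReal k
  set m := n - p - 1
  have hm : m + Fintype.card (Fin p) + 1 = Fintype.card (Fin n) := by
    simp only [Fintype.card_fin]
    omega
  simp only [intLikGL_eq_orbitIntegral] at hfin hle ⊢
  set N₀ := orbitIntegral m F₀
  set N₁ := orbitIntegral m F₁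
  set T : Set (Fin n → Fin p → ℝ) := {X | c * N₀ X < N₁ X}
  have hN₀ : Measurable N₀ := measurable_orbitIntegral m hF₀
  have hN₁ : Measurable N₁ := measurable_orbitIntegral m hF₁
  have hT : MeasurableSet T := measurableSet_lt (hN₀.const_mul c) hN₁
  have hTact : ∀ (a : Fin p → ℝ) (B : Matrix (Fin p) (Fin p) ℝ), B.det ≠ 0 →
      ∀ X, X ∈ T ↔ affineAct a B X ∈ T := by
    intro a B hB X
    have hd : ENNReal.ofReal |B.det| ^ (m + Fintype.card (Fin p)) ≠ 0 := by simp [hB]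
    have hd' : ENNReal.ofReal |B.det| ^ (m + Fintype.card (Fin p)) ≠ ⊤ := by finiteness
    change c * N₀ X < N₁ X ↔ c * N₀ (affineAct a B X) < N₁ (affineAct a B X)
    rw [← show _ = N₀ X from orbitIntegral_affineAct m hF₀ a hB X,
      ← show _ = N₁ X from orbitIntegral_affineAct m hF₁ a hB X, mul_left_comm,
      ENNReal.mul_lt_mul_iff_right hd hd']
  have hN : ∀ᵐ X, N₀ X < ⊤ ∧ 0 < N₀ X := hfin.mono fun X hX => ⟨hX.1, hX.2.2⟩
  have hratio := fun {S : Set (Fin n → Fin p → ℝ)} =>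
    setLIntegral_eq_ratio_orbitIntegral m hm hF₀ hF₁ hN (S := S)
  refine setLIntegral_le_of_neymanPearson (c := c) hR hT
    (lintegral_prod_ofReal_ne_top hf0m hf0nn (by simp [hf0d])) ?_ ?_ hle
  · rw [hratio (hT.diff hR) fun a B hB X => and_congr (hTact a B hB X) (hRact a B hB X).not,
      ← lintegral_const_mul _ hF₀]
    refine setLIntegral_mono_ae' (hT.diff hR) ?_
    filter_upwards [hN] with X hX hXT
    gcongr
    rw [mul_comm, ← div_eq_mul_inv, ENNReal.le_div_iff_mul_le (.inl hX.2.ne') (.inl hX.1.ne)]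
    exact hXT.1.le
  · rw [hratio (hR.diff hT) fun a B hB X => and_congr (hRact a B hB X) (hTact a B hB X).not,
      ← lintegral_const_mul _ hF₀]
    refine setLIntegral_mono_ae' (hR.diff hT) ?_
    filter_upwards [hN] with X hX hXT
    gcongr
    rw [mul_comm, ← div_eq_mul_inv]
    exact ENNReal.div_le_of_le_mul (not_lt.1 hXT.2)
end
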